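/- Let X ⊂ ℝ^{n+1} be a convex surface and let (e₁,V₁) and (e₂,V₂) give standard charts on X with associated convex functions f₁ and f₂. Set g(x₁,x₂) := dist_X(x₁ + f₁(x₁)e₁, x₂ + f₂(x₂)e₂)² for x₁ ∈ V₁, x₂ ∈ V₂, let L := max(Lip f₁, Lip f₂), and let M := sup_{x,y∈X} dist_X(x,y) be the intrinsic diameter of X. Then the function (x₁,x₂) ↦ g(x₁,x₂) − 4(1+L²)(‖x₁‖² + ‖x₂‖²) − 4M(f₁(x₁) + f₂(x₂)) is concave on the convex set V₁ × V₂. -/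

import Mathlib

open Set
open scoped NNReal

/-- A convex body: a compact convex set with nonempty interior. -/
def IsConvexBody {E : Type*} [NormedAddCommGroup E] [NormedSpace ℝ E] (C : Set E) : Prop :=
  IsCompact C ∧ Convex ℝ C ∧ (interior C).Nonempty

/-- A convex surface: the boundary of a convex body. -/
def IsConvexSurface {E : Type*} [NormedAddCommGroup E] [NormedSpace ℝ E] (X : Set E) : Prop :=
  ∃ C : Set E, IsConvexBody C ∧ X = frontier C

/-- The intrinsic distance on `X ⊆ E`: the infimum of lengths (total variations) of
continuous curves `γ : [0,1] → E` joining `a` and `b` within `X`. -/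
noncomputable def intrinsicDist {E : Type*} [NormedAddCommGroup E] [NormedSpace ℝ E]
    (X : Set E) (a b : E) : ℝ :=
  (⨅ γ : {γ : ℝ → E // ContinuousOn γ (Set.Icc 0 1) ∧ γ 0 = a ∧ γ 1 = b ∧
      Set.MapsTo γ (Set.Icc 0 1) X},
    eVariationOn γ.1 (Set.Icc 0 1)).toReal

/-- An `(e,V)`-standard chart on `X`, given by a unit vector `e`, a convex open subset `V`
of the hyperplane `e^⊥`, and a Lipschitz convex function `f : V → ℝ` whose graph
`{x + f(x)e : x ∈ V}` is a relatively open subset of `X`. -/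
def IsStandardChart {E : Type*} [NormedAddCommGroup E] [InnerProductSpace ℝ E]
    (X : Set E) (e : E) (V : Set ↥((Submodule.span ℝ {e})ᗮ))
    (f : ↥((Submodule.span ℝ {e})ᗮ) → ℝ) : Prop :=
  ‖e‖ = 1 ∧ IsOpen V ∧ Convex ℝ V ∧ ConvexOn ℝ V f ∧
    (∃ K : ℝ≥0, LipschitzOnWith K f V) ∧
    ∃ O : Set E, IsOpen O ∧
      (fun x : ↥((Submodule.span ℝ {e})ᗮ) => (x : E) + f x • e) '' V = X ∩ O

/-- The least Lipschitz constant of `f` on `s`. -/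
noncomputable def lipConstOn {α β : Type*} [PseudoMetricSpace α] [PseudoMetricSpace β]
    (f : α → β) (s : Set α) : ℝ≥0 :=
  sInf {K : ℝ≥0 | LipschitzOnWith K f s}

/-- The intrinsic diameter of `X`. -/
noncomputable def intrinsicDiam {E : Type*} [NormedAddCommGroup E] [NormedSpace ℝ E]
    (X : Set E) : ℝ :=
  sSup {d : ℝ | ∃ x ∈ X, ∃ y ∈ X, intrinsicDist X x y = d}

/-- The extended-real-valued intrinsic distance on a set. -/
noncomputable def intrinsicEDist {E : Type*} [NormedAddCommGroup E] [NormedSpace ℝ E]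
    (X : Set E) (a b : E) : ENNReal :=
  ⨅ γ : {γ : ℝ → E // ContinuousOn γ (Set.Icc 0 1) ∧ γ 0 = a ∧ γ 1 = b ∧
      Set.MapsTo γ (Set.Icc 0 1) X},
    eVariationOn γ.1 (Set.Icc 0 1)

section IntrinsicEDist

variable {E : Type*} [NormedAddCommGroup E] [NormedSpace ℝ E]

theorem intrinsicEDist_le {X : Set E} {a b : E} {γ : ℝ → E} (hc : ContinuousOn γ (Icc 0 1))
    (h0 : γ 0 = a) (h1 : γ 1 = b) (hm : MapsTo γ (Icc 0 1) X) :
    intrinsicEDist X a b ≤ eVariationOn γ (Icc 0 1) :=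
  iInf_le (fun γ : {γ : ℝ → E // ContinuousOn γ (Set.Icc 0 1) ∧ γ 0 = a ∧ γ 1 = b ∧
      Set.MapsTo γ (Set.Icc 0 1) X} => eVariationOn γ.1 (Set.Icc 0 1)) ⟨γ, hc, h0, h1, hm⟩

theorem le_intrinsicEDist {X : Set E} {a b : E} {r : ENNReal}
    (h : ∀ γ : ℝ → E, ContinuousOn γ (Icc 0 1) → γ 0 = a → γ 1 = b → MapsTo γ (Icc 0 1) X →
      r ≤ eVariationOn γ (Icc 0 1)) : r ≤ intrinsicEDist X a b :=
  le_iInf fun γ => h γ.1 γ.2.1 γ.2.2.1 γ.2.2.2.1 γ.2.2.2.2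

theorem edist_le_intrinsicEDist (X : Set E) (a b : E) : edist a b ≤ intrinsicEDist X a b := by
  refine le_intrinsicEDist fun γ _ h0 h1 _ => ?_
  rw [← h0, ← h1]
  exact eVariationOn.edist_le γ (by simp) (by simp)

theorem intrinsicEDist_le_edist {X : Set E} {a b : E} (h : segment ℝ a b ⊆ X) :
    intrinsicEDist X a b ≤ edist a b := by
  have hl : LipschitzWith (nndist a b) (AffineMap.lineMap a b : ℝ → E) := lipschitzWith_lineMap a b
  refine (intrinsicEDist_le (γ := AffineMap.lineMap a b) hl.continuous.continuousOn (by simp)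
    (by simp) ?_).trans ?_
  · intro t ht
    apply h
    rw [segment_eq_image_lineMap]
    exact mem_image_of_mem _ ht
  · have h1 := (hl.lipschitzOnWith (s := univ)).comp_eVariationOn_le
      (g := (id : ℝ → ℝ)) (s := Icc 0 1) (mapsTo_univ _ _)
    have h2 := (monotone_id.monotoneOn (Icc (0 : ℝ) 1)).eVariationOn_eq
      (left_mem_Icc.2 zero_le_one) (right_mem_Icc.2 zero_le_one)
    simp only [Function.comp_id, inter_self, id, sub_zero, ENNReal.ofReal_one] at h1 h2
    calc _ ≤ _ := h1
      _ = nndist a b * 1 := by rw [h2]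
      _ = edist a b := by rw [mul_one, edist_nndist]

theorem intrinsicEDist_map_le {F : Type*} [NormedAddCommGroup F] [NormedSpace ℝ F] {X : Set E}
    {Y : Set F} {g : E → F} {K : ℝ≥0} (hK : K ≠ 0) (hg : LipschitzOnWith K g X)
    (hm : MapsTo g X Y) (a b : E) :
    intrinsicEDist Y (g a) (g b) ≤ K * intrinsicEDist X a b := by
  unfold intrinsicEDist
  rw [ENNReal.mul_iInf_of_ne (by simpa using hK) (by simp)]
  refine le_iInf fun γ => ?_
  refine (intrinsicEDist_le (γ := g ∘ γ.1) (hg.continuousOn.comp γ.2.1 γ.2.2.2.2)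
    (by simp [γ.2.2.1]) (by simp [γ.2.2.2.1]) (hm.comp γ.2.2.2.2)).trans ?_
  exact hg.comp_eVariationOn_le γ.2.2.2.2

theorem intrinsicEDist_triangle (X : Set E) (a b c : E) :
    intrinsicEDist X a c ≤ intrinsicEDist X a b + intrinsicEDist X b c := by
  conv_rhs => unfold intrinsicEDist
  refine ENNReal.le_iInf_add_iInf fun ⟨γ, hγ, hγ0, hγ1, hγm⟩ ⟨η, hη, hη0, hη1, hηm⟩ => ?_
  let θ : ℝ → E := fun t => if t ≤ 1 / 2 then γ (2 * t) else η (2 * t - 1)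
  have h12 : Icc (0 : ℝ) 1 = Icc 0 (1 / 2) ∪ Icc (1 / 2) 1 :=
    (Icc_union_Icc_eq_Icc (by norm_num) (by norm_num)).symm
  have e1 : EqOn θ (γ ∘ fun t => 2 * t) (Icc 0 (1 / 2)) := fun t ht => if_pos ht.2
  have e2 : EqOn θ (η ∘ fun t => 2 * t - 1) (Icc (1 / 2) 1) := by
    intro t ht
    rcases ht.1.eq_or_lt with h | h
    · subst h; simp [θ, hγ1, hη0]
    · exact if_neg (not_le.2 h)
  have m1 : MapsTo (fun t : ℝ => 2 * t) (Icc 0 (1 / 2)) (Icc 0 1) := fun t ht =>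
    ⟨by linarith [ht.1], by linarith [ht.2]⟩
  have m2 : MapsTo (fun t : ℝ => 2 * t - 1) (Icc (1 / 2) 1) (Icc 0 1) := fun t ht =>
    ⟨by linarith [ht.1], by linarith [ht.2]⟩
  refine (intrinsicEDist_le (γ := θ) ?_ ?_ ?_ ?_).trans ?_
  · rw [h12]
    refine ContinuousOn.union_of_isClosed ?_ ?_ isClosed_Icc isClosed_Icc
    · exact (hγ.comp (by fun_prop) m1).congr e1
    · exact (hη.comp (by fun_prop) m2).congr e2
  · simp [θ, hγ0]
  · simp only [θ]; norm_num; exact hη1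
  · rw [h12]
    rintro t (ht | ht)
    · rw [e1 ht]; exact hγm (m1 ht)
    · rw [e2 ht]; exact hηm (m2 ht)
  · have := eVariationOn.Icc_add_Icc θ (s := univ) (a := 0) (b := 1 / 2) (c := 1)
      (by norm_num) (by norm_num) (mem_univ _)
    simp only [univ_inter] at this
    rw [← this, eVariationOn.congr e1, eVariationOn.congr e2]
    gcongr
    · exact eVariationOn.comp_le_of_monotoneOn _ _ (fun x _ y _ h => by linarith) m1
    · exact eVariationOn.comp_le_of_monotoneOn _ _ (fun x _ y _ h => by linarith) m2

end IntrinsicEDist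

section HingeChain

open Filter Topology
open scoped RealInnerProductSpace

/-- `HingeChain H m a b r` says that `a` and `b` are joined by a polygon of length `r` with `m`
edges, each of which has both endpoints in one of the sets `H i`. -/
inductive HingeChain {E ι : Type*} [PseudoMetricSpace E] (H : ι → Set E) : ℕ → E → E → ℝ → Prop
  | single {i : ι} {a b : E} (ha : a ∈ H i) (hb : b ∈ H i) : HingeChain H 1 a b (dist a b)
  | cons {i : ι} {m : ℕ} {a z b : E} {r : ℝ} (ha : a ∈ H i) (hz : z ∈ H i)
      (h : HingeChain H m z b r) : HingeChain H (m + 1) a b (dist a z + r)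

theorem HingeChain.one_le {E ι : Type*} [PseudoMetricSpace E] {H : ι → Set E} {m : ℕ} {a b : E}
    {r : ℝ} (h : HingeChain H m a b r) : 1 ≤ m := by
  cases h <;> omega

theorem HingeChain.dist_le {E ι : Type*} [PseudoMetricSpace E] {H : ι → Set E} {m : ℕ} {a b : E}
    {r : ℝ} (h : HingeChain H m a b r) : dist a b ≤ r := by
  induction h with
  | single => exact le_rfl
  | @cons i m a z b r _ _ _ ih => linarith [dist_triangle a z b]

/-- A hinge chain of least length and, among those, with the least number of edges. -/
def IsMinimalChain {E ι : Type*} [PseudoMetricSpace E] (H : ι → Set E) (m : ℕ) (a b : E)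
    (r : ℝ) : Prop :=
  (∀ m' r', HingeChain H m' a b r' → r ≤ r') ∧ ∀ m', HingeChain H m' a b r → m ≤ m'

theorem eq_zero_of_forall_le_quadratic {α β : ℝ} (hβ : 0 ≤ β) (h : ∀ t : ℝ, 0 ≤ t * α + t ^ 2 * β) :
    α = 0 := by
  have h1 := h (-α / (2 * (β + 1)))
  have h2 : -α / (2 * (β + 1)) * α + (-α / (2 * (β + 1))) ^ 2 * β
      = -(α ^ 2 * (β + 2)) / (4 * (β + 1) ^ 2) := by
    field_simp
    ring
  rw [h2, neg_div, neg_nonneg] at h1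
  by_contra hα
  have : 0 < α ^ 2 * (β + 2) / (4 * (β + 1) ^ 2) := by positivity
  linarith

variable {E : Type*} [NormedAddCommGroup E] [InnerProductSpace ℝ E]

theorem norm_add_le_quadratic {x : E} (hx : x ≠ 0) (w : E) :
    ‖x + w‖ ≤ ‖x‖ + ⟪x, w⟫ / ‖x‖ + ‖w‖ ^ 2 / (2 * ‖x‖) := by
  have h0 : 0 < ‖x‖ := norm_pos_iff.2 hx
  have h1 := norm_add_sq_real x w
  have h2 : ‖x‖ + ⟪x, w⟫ / ‖x‖ + ‖w‖ ^ 2 / (2 * ‖x‖) = (‖x + w‖ ^ 2 + ‖x‖ ^ 2) / (2 * ‖x‖) := by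
    rw [h1]
    field_simp
    ring
  rw [h2, le_div_iff₀ (by positivity)]
  nlinarith [sq_nonneg (‖x + w‖ - ‖x‖)]

theorem inner_eq_of_forall_norm_add_le {u₁ u₂ w : E} {ℓ₁ ℓ₂ : ℝ} (h₁ : 0 < ℓ₁) (h₂ : 0 < ℓ₂)
    (hu₁ : ‖u₁‖ = 1) (hu₂ : ‖u₂‖ = 1)
    (h : ∀ t : ℝ, ℓ₁ + ℓ₂ ≤ ‖ℓ₁ • u₁ + t • w‖ + ‖ℓ₂ • u₂ - t • w‖) : ⟪u₁, w⟫ = ⟪u₂, w⟫ := by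
  have hn₁ : ‖ℓ₁ • u₁‖ = ℓ₁ := by rw [norm_smul, hu₁, mul_one, Real.norm_of_nonneg h₁.le]
  have hn₂ : ‖ℓ₂ • u₂‖ = ℓ₂ := by rw [norm_smul, hu₂, mul_one, Real.norm_of_nonneg h₂.le]
  have hz₁ : ℓ₁ • u₁ ≠ 0 := by rw [← norm_pos_iff, hn₁]; exact h₁
  have hz₂ : ℓ₂ • u₂ ≠ 0 := by rw [← norm_pos_iff, hn₂]; exact h₂
  rw [← sub_eq_zero]
  refine eq_zero_of_forall_le_quadratic (β := ‖w‖ ^ 2 / (2 * ℓ₁) + ‖w‖ ^ 2 / (2 * ℓ₂))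
    (by positivity) fun t => ?_
  have e₁ := norm_add_le_quadratic hz₁ (t • w)
  have e₂ := norm_add_le_quadratic hz₂ (-(t • w))
  rw [← sub_eq_add_neg] at e₂
  rw [hn₁, inner_smul_left, inner_smul_right, norm_smul, mul_pow, Real.norm_eq_abs, sq_abs] at e₁
  rw [hn₂, inner_neg_right, inner_smul_left, inner_smul_right, norm_neg, norm_smul, mul_pow,
    Real.norm_eq_abs, sq_abs] at e₂
  simp only [conj_trivial] at e₁ e₂
  rw [mul_div_cancel_left₀ _ h₁.ne'] at e₁
  rw [neg_div, mul_div_cancel_left₀ _ h₂.ne'] at e₂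
  have := h t
  have e : t * (⟪u₁, w⟫ - ⟪u₂, w⟫) + t ^ 2 * (‖w‖ ^ 2 / (2 * ℓ₁) + ‖w‖ ^ 2 / (2 * ℓ₂))
     = t * ⟪u₁, w⟫ + -(t * ⟪u₂, w⟫) + t ^ 2 * ‖w‖ ^ 2 / (2 * ℓ₁) + t ^ 2 * ‖w‖ ^ 2 / (2 * ℓ₂) := by
    ring
  linarith

/-- The reflection exchanging two unit vectors whose difference is orthogonal to the intersection
of two hyperplanes transverse to them maps one hyperplane to the other. -/
theorem exists_hinge_isometry {n₁ n₂ u₁ u₂ : E} (hu₁ : ‖u₁‖ = 1) (hu₂ : ‖u₂‖ = 1)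
    (h₁ : ⟪n₁, u₁⟫ = 0) (h₂ : ⟪n₂, u₂⟫ = 0) (h₂₁ : ⟪n₂, u₁⟫ ≠ 0)
    (hw : ∀ w, ⟪n₁, w⟫ = 0 → ⟪n₂, w⟫ = 0 → ⟪u₁, w⟫ = ⟪u₂, w⟫) :
    ∃ T : E ≃ₗᵢ[ℝ] E, T u₂ = u₁ ∧ (∀ w, ⟪n₁, w⟫ = 0 → ⟪n₂, w⟫ = 0 → T w = w) ∧
      ∀ k, ⟪n₂, k⟫ = 0 → ⟪n₁, T k⟫ = 0 := by
  have h₁₂ : ⟪n₁, u₂⟫ ≠ 0 := by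
    intro h
    have h3 := hw u₂ h h₂
    rw [real_inner_self_eq_norm_sq, hu₂, one_pow, inner_eq_one_iff_of_norm_eq_one hu₁ hu₂] at h3
    exact h₂₁ (h3 ▸ h₂)
  have hTu : (ℝ ∙ (u₂ - u₁))ᗮ.reflection u₂ = u₁ := Submodule.reflection_sub (by rw [hu₁, hu₂])
  have hTw : ∀ w, ⟪n₁, w⟫ = 0 → ⟪n₂, w⟫ = 0 → (ℝ ∙ (u₂ - u₁))ᗮ.reflection w = w := by
    intro w a b
    apply Submodule.reflection_mem_subspace_eq_self
    rw [Submodule.mem_orthogonal_singleton_iff_inner_right, inner_sub_left, hw w a b, sub_self]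
  refine ⟨(ℝ ∙ (u₂ - u₁))ᗮ.reflection, hTu, hTw, fun k hk => ?_⟩
  set d := ⟪n₁, k⟫ / ⟪n₁, u₂⟫ with hd
  have ha : ⟪n₁, k - d • u₂⟫ = 0 := by
    rw [inner_sub_right, inner_smul_right, hd, div_mul_cancel₀ _ h₁₂, sub_self]
  have hb : ⟪n₂, k - d • u₂⟫ = 0 := by
    rw [inner_sub_right, inner_smul_right, hk, h₂, mul_zero, sub_zero]
  have : k = (k - d • u₂) + d • u₂ := by abel
  rw [this, map_add, map_smul, hTu, hTw _ ha hb, inner_add_right, ha, inner_smul_right, h₁]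
  simp

/-- Unfolding a minimal hinge chain in a family of hyperplanes: after developing all hyperplanes
along the chain, the chain becomes a straight segment, and nearby segments of the development are
again developments of hinge chains. -/
theorem HingeChain.exists_development {ι : Type*} {ν : ι → E} {c : ι → ℝ} {m : ℕ} {a b : E} {r : ℝ}
    (h : HingeChain (fun i => {x | ⟪ν i, x⟫ = c i}) m a b r)
    (hmin : IsMinimalChain (fun i => {x | ⟪ν i, x⟫ = c i}) m a b r) (hab : a ≠ b) :
    ∃ (i j : ι) (p : E) (R : E ≃ₗᵢ[ℝ] E), ⟪ν i, a⟫ = c i ∧ ⟪ν i, p⟫ = c i ∧ a ≠ p ∧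
      ⟪ν j, b⟫ = c j ∧ (∀ k, ⟪ν j, k⟫ = 0 → ⟪ν i, R k⟫ = 0) ∧
      (∀ z, ⟪ν i, z⟫ = c i → HingeChain (fun i => {x | ⟪ν i, x⟫ = c i}) m z b
        (dist z p + (r - dist a p))) ∧
      ∀ᶠ q : E × E in 𝓝 (0, 0), ⟪ν i, q.1⟫ = 0 → ⟪ν j, q.2⟫ = 0 →
        ∃ r' ≤ ‖(r / dist a p) • (p - a) + R q.2 - q.1‖,
          HingeChain (fun i => {x | ⟪ν i, x⟫ = c i}) m (a + q.1) (b + q.2) r' := by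
  induction h with
  | @single i a b ha hb =>
    refine ⟨i, i, b, LinearIsometryEquiv.refl ℝ E, ha, hb, hab, hb, fun k hk => hk, fun z hz => ?_,
      Eventually.of_forall fun q h1 h2 => ⟨_, ?_, HingeChain.single (i := i) ?_ ?_⟩⟩
    · simpa using HingeChain.single (H := fun i => {x | ⟪ν i, x⟫ = c i}) hz hb
    · rw [div_self (dist_ne_zero.2 hab), dist_comm, dist_eq_norm]
      apply le_of_eq
      congr 1
      simp
      abel
    · simpa [inner_add_right, h1] using ha
    · simpa [inner_add_right, h2] using hb
  | @cons i m a z b s ha hz h ih =>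
    obtain ⟨hlen, hst⟩ := hmin
    replace ha : ⟪ν i, a⟫ = c i := ha
    replace hz : ⟪ν i, z⟫ = c i := hz
    have haz : a ≠ z := by
      rintro rfl
      have := hst m (by simpa using h)
      omega
    have hzb : z ≠ b := by
      rintro rfl
      have h1 := hlen 1 _ (HingeChain.single (i := i) ha hz)
      have h2 := h.dist_le
      have h3 := hst 1 (by
        convert HingeChain.single (H := fun i => {x | ⟪ν i, x⟫ = c i}) (i := i) ha hz using 1
        rw [dist_self] at h2
        linarith)
      have := h.one_le
      omega
    obtain ⟨j, k, p, R', hzj, hpj, hzp, hbk, hR', hchain, hev⟩ := ih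
      ⟨fun m' r' h' => by
        have := hlen _ _ (HingeChain.cons (i := i) ha hz h')
        linarith, fun m' h' => by
        have := hst _ (HingeChain.cons (i := i) ha hz h')
        omega⟩ hzb
    have hs : 0 < s := (dist_pos.2 hzb).trans_le h.dist_le
    set ℓ₁ := dist a z with hℓ₁
    set ℓ₂ := dist z p with hℓ₂
    have hℓ₁0 : 0 < ℓ₁ := dist_pos.2 haz
    have hℓ₂0 : 0 < ℓ₂ := dist_pos.2 hzp
    set u₁ := ℓ₁⁻¹ • (z - a) with hu₁
    set u₂ := ℓ₂⁻¹ • (p - z) with hu₂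
    have e₁ : z - a = ℓ₁ • u₁ := by rw [hu₁, smul_inv_smul₀ hℓ₁0.ne']
    have e₂ : p - z = ℓ₂ • u₂ := by rw [hu₂, smul_inv_smul₀ hℓ₂0.ne']
    have n₁ : ‖u₁‖ = 1 := by
      rw [hu₁, norm_smul, norm_inv, Real.norm_of_nonneg hℓ₁0.le, ← dist_eq_norm, dist_comm, ← hℓ₁,
        inv_mul_cancel₀ hℓ₁0.ne']
    have n₂ : ‖u₂‖ = 1 := by
      rw [hu₂, norm_smul, norm_inv, Real.norm_of_nonneg hℓ₂0.le, ← dist_eq_norm, dist_comm, ← hℓ₂,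
        inv_mul_cancel₀ hℓ₂0.ne']
    have i₁ : ⟪ν i, u₁⟫ = 0 := by
      rw [hu₁, inner_smul_right, inner_sub_right, hz, ha, sub_self, mul_zero]
    have i₂ : ⟪ν j, u₂⟫ = 0 := by
      rw [hu₂, inner_smul_right, inner_sub_right, hpj, hzj, sub_self, mul_zero]
    have i₂₁ : ⟪ν j, u₁⟫ ≠ 0 := by
      intro h0
      have haj : ⟪ν j, a⟫ = c j := by
        have : a = z - ℓ₁ • u₁ := by rw [← e₁]; abel
        rw [this, inner_sub_right, inner_smul_right, h0, hzj, mul_zero, sub_zero]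
      have h1 := hchain a haj
      have h2 := hlen _ _ h1
      have h3 := hst m (by
        convert h1 using 1
        have := dist_triangle a z p
        linarith)
      omega
    have hw : ∀ w, ⟪ν i, w⟫ = 0 → ⟪ν j, w⟫ = 0 → ⟪u₁, w⟫ = ⟪u₂, w⟫ := by
      intro w hwi hwj
      refine inner_eq_of_forall_norm_add_le hℓ₁0 hℓ₂0 n₁ n₂ fun t => ?_
      have h1 : ⟪ν j, z + t • w⟫ = c j := by
        rw [inner_add_right, inner_smul_right, hwj, hzj, mul_zero, add_zero]
      have h2 : ⟪ν i, z + t • w⟫ = c i := by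
        rw [inner_add_right, inner_smul_right, hwi, hz, mul_zero, add_zero]
      have h3 := hlen _ _ (HingeChain.cons (i := i) ha h2 (hchain _ h1))
      have e3 : dist a (z + t • w) = ‖ℓ₁ • u₁ + t • w‖ := by
        rw [dist_comm, dist_eq_norm, ← e₁]; congr 1; abel
      have e4 : dist (z + t • w) p = ‖ℓ₂ • u₂ - t • w‖ := by
        rw [dist_comm, dist_eq_norm, ← e₂]; congr 1; abel
      rw [e3, e4] at h3
      linarith
    obtain ⟨T, hTu, hTw, hT⟩ := exists_hinge_isometry n₁ n₂ i₁ i₂ i₂₁ hw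
    refine ⟨i, k, z, R'.trans T, ha, hz, haz, hbk, fun x hx => hT _ (hR' x hx), fun y hy => ?_, ?_⟩
    · convert HingeChain.cons (i := i) (H := fun i => {x | ⟪ν i, x⟫ = c i}) hy hz h using 1
      rw [← hℓ₁]; ring
    · set r := ℓ₁ + s with hr
      have hr0 : 0 < r := by positivity
      let v : E × E → E := fun q => r • u₁ + T (R' q.2) - q.1
      let τ : E × E → ℝ := fun q => ⟪ν j, ℓ₁ • u₁ - q.1⟫ / ⟪ν j, v q⟫
      let ζ : E × E → E := fun q => τ q • v q + q.1 - ℓ₁ • u₁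
      have hvc : Continuous v := by fun_prop
      have hv0 : v (0, 0) = r • u₁ := by simp [v]
      have hv0' : ⟪ν j, v (0, 0)⟫ ≠ 0 := by
        rw [hv0, inner_smul_right]; exact mul_ne_zero hr0.ne' i₂₁
      have hτc : ContinuousAt τ (0, 0) := by
        refine ContinuousAt.div (Continuous.continuousAt ?_) (Continuous.continuousAt ?_) hv0' <;>
          fun_prop
      have hτ0 : τ (0, 0) = ℓ₁ / r := by
        simp only [τ, hv0, sub_zero, inner_smul_right]
        rw [mul_div_mul_right _ _ i₂₁]
      have hζc : ContinuousAt ζ (0, 0) := by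
        have := hvc.continuousAt (x := (0, 0))
        fun_prop
      have hζ0 : ζ (0, 0) = 0 := by
        simp only [ζ, hτ0, hv0, smul_smul, div_mul_cancel₀ _ hr0.ne']
        simp
      have t1 : ∀ᶠ q in 𝓝 ((0, 0) : E × E), 0 ≤ τ q := by
        refine Tendsto.eventually_const_le ?_ hτc
        rw [hτ0]; positivity
      have t2 : ∀ᶠ q in 𝓝 ((0, 0) : E × E), τ q ≤ 1 := by
        refine Tendsto.eventually_le_const ?_ hτc
        rw [hτ0, div_lt_one hr0]; linarith
      have t3 : ∀ᶠ q in 𝓝 ((0, 0) : E × E), ⟪ν j, v q⟫ ≠ 0 :=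
        ContinuousAt.eventually_ne (by fun_prop) hv0'
      have t4 : Tendsto (fun q => (ζ q, q.2)) (𝓝 ((0, 0) : E × E)) (𝓝 (0, 0)) := by
        have : ContinuousAt (fun q => (ζ q, q.2)) ((0, 0) : E × E) :=
          hζc.prodMk continuousAt_snd
        simpa [ContinuousAt, hζ0] using this
      filter_upwards [t1, t2, t3, t4.eventually hev] with q q1 q2 q3 q4 hq1 hq2
      have hvi : ⟪ν i, v q⟫ = 0 := by
        simp only [v, inner_sub_right, inner_add_right, inner_smul_right, i₁, hT _ (hR' _ hq2), hq1]
        simp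
      have hζi : ⟪ν i, ζ q⟫ = 0 := by
        simp only [ζ, inner_sub_right, inner_add_right, inner_smul_right, i₁, hvi, hq1]
        simp
      have hζj : ⟪ν j, ζ q⟫ = 0 := by
        simp only [ζ]
        rw [add_sub_assoc, inner_add_right, inner_smul_right, div_mul_cancel₀ _ q3, ← inner_add_right]
        simp
      obtain ⟨r', hr', hc⟩ := q4 hζj hq2
      refine ⟨_, ?_, HingeChain.cons (i := i) (z := z + ζ q) ?_ ?_ hc⟩
      · have f1 : dist (a + q.1) (z + ζ q) = τ q * ‖v q‖ := by
          rw [dist_comm, dist_eq_norm, ← norm_smul_of_nonneg q1]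
          congr 1
          have : z = a + ℓ₁ • u₁ := by rw [← e₁]; abel
          simp only [ζ, this]
          abel
        have f2 : ‖(s / ℓ₂) • (p - z) + R' q.2 - ζ q‖ = (1 - τ q) * ‖v q‖ := by
          rw [← T.norm_map, ← norm_smul_of_nonneg (sub_nonneg.2 q2), map_sub, map_add, e₂, smul_smul,
            div_mul_cancel₀ _ hℓ₂0.ne', map_smul, hTu, hTw _ hζi hζj]
          congr 1
          simp only [ζ, v, hr]
          module
        have f3 : (r / ℓ₁) • (z - a) + (R'.trans T) q.2 - q.1 = v q := by
          rw [e₁, smul_smul, div_mul_cancel₀ _ hℓ₁0.ne']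
          rfl
        rw [f3, f1]
        have : r' ≤ (1 - τ q) * ‖v q‖ := f2 ▸ hr'
        linarith
      · change ⟪ν i, _⟫ = _
        rw [inner_add_right, ha, hq1, add_zero]
      · change ⟪ν i, _⟫ = _
        rw [inner_add_right, hz, hζi, add_zero]

end HingeChain

section Projection

open scoped RealInnerProductSpace

variable {E : Type*} [NormedAddCommGroup E] [InnerProductSpace ℝ E]

/-- The metric projection onto a complete convex set. -/
theorem exists_metricProjection {K : Set E} (hne : K.Nonempty) (hcomp : IsComplete K)
    (hconv : Convex ℝ K) :
    ∃ π : E → E, LipschitzWith 1 π ∧ (∀ x, π x ∈ K) ∧ (∀ x ∈ K, π x = x) ∧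
      ∀ U, IsOpen U → U ⊆ K → ∀ x ∉ U, π x ∉ U := by
  choose π hπ hπ' using fun x => exists_norm_eq_iInf_of_complete_convex hne hcomp hconv x
  have hin : ∀ x, ∀ y ∈ K, ⟪x - π x, y - π x⟫ ≤ 0 := fun x =>
    (norm_eq_iInf_iff_real_inner_le_zero hconv (hπ x)).1 (hπ' x)
  refine ⟨π, LipschitzWith.of_dist_le_mul fun x y => ?_, hπ, fun x hx => ?_, ?_⟩
  · rw [NNReal.coe_one, one_mul, dist_eq_norm, dist_eq_norm]
    have h1 := hin x _ (hπ y)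
    have h2 := hin y _ (hπ x)
    have h3 : ‖π x - π y‖ ^ 2 ≤ ⟪x - y, π x - π y⟫ := by
      have e : ⟪x - y, π x - π y⟫
          = ‖π x - π y‖ ^ 2 - ⟪x - π x, π y - π x⟫ - ⟪y - π y, π x - π y⟫ := by
        have : x - y = (π x - π y) + (x - π x) - (y - π y) := by abel
        rw [this, inner_sub_left, inner_add_left, real_inner_self_eq_norm_sq,
          ← neg_sub (π x) (π y), inner_neg_right]
        ring
      linarith
    have h4 := h3.trans (real_inner_le_norm _ _)
    rcases (norm_nonneg (π x - π y)).eq_or_lt with h | h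
    · rw [← h]; positivity
    · rw [sq] at h4
      exact le_of_mul_le_mul_right h4 h
  · have := hin x x hx
    rw [real_inner_self_eq_norm_sq] at this
    have h0 : ‖x - π x‖ = 0 := by
      have := sq_nonneg ‖x - π x‖
      exact pow_eq_zero_iff two_ne_zero |>.1 (by linarith)
    exact (sub_eq_zero.1 (norm_eq_zero.1 h0)).symm
  · intro U hU hUK x hx hmem
    have hcont : Continuous fun s : ℝ => π x + s • (x - π x) := by fun_prop
    have hev : ∀ᶠ s in nhds (0 : ℝ), π x + s • (x - π x) ∈ U :=
      hcont.continuousAt.eventually (hU.mem_nhds (by simpa using hmem))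
    obtain ⟨s, hs, hs0⟩ := ((hev.filter_mono nhdsWithin_le_nhds).and
      (self_mem_nhdsWithin : Ioi (0 : ℝ) ∈ nhdsWithin 0 (Ioi 0))).exists
    have h1 := hin x _ (hUK hs)
    rw [add_sub_cancel_left, inner_smul_right, real_inner_self_eq_norm_sq] at h1
    have h2 : ‖x - π x‖ ^ 2 ≤ 0 := by
      by_contra h
      push Not at h
      have := mul_pos (mem_Ioi.1 hs0) h
      linarith
    have h0 : ‖x - π x‖ = 0 := pow_eq_zero_iff two_ne_zero |>.1 (le_antisymm h2 (sq_nonneg _))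
    exact hx ((sub_eq_zero.1 (norm_eq_zero.1 h0)).symm ▸ hmem)

end Projection

section HingeChainExistence

open Filter Topology

variable {E : Type*} [NormedAddCommGroup E] [NormedSpace ℝ E] {ι : Type*}

theorem HingeChain.intrinsicEDist_le {H : ι → Set E} (hconv : ∀ i, Convex ℝ (H i)) {X : Set E}
    (hX : ∀ i, H i ⊆ X) {m : ℕ} {a b : E} {r : ℝ} (h : HingeChain H m a b r) :
    intrinsicEDist X a b ≤ ENNReal.ofReal r := by
  have key : ∀ {i a b}, a ∈ H i → b ∈ H i → intrinsicEDist X a b ≤ ENNReal.ofReal (dist a b) := by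
    intro i a b ha hb
    rw [← edist_dist]
    exact intrinsicEDist_le_edist (((hconv i).segment_subset ha hb).trans (hX i))
  induction h with
  | single ha hb => exact key ha hb
  | @cons i m a z b r ha hz h ih =>
    rw [ENNReal.ofReal_add dist_nonneg (dist_nonneg.trans h.dist_le)]
    exact (intrinsicEDist_triangle X a z b).trans (add_le_add (key ha hz) ih)

/-- A curve covered by finitely many closed sets is at least as long as some hinge chain. -/
theorem exists_hingeChain_le_eVariationOn {E ι : Type*} [NormedAddCommGroup E] {H : ι → Set E}
    (hcl : ∀ i, IsClosed (H i)) {γ : ℝ → E} (S : Finset ι) :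
    ∀ s ∈ Icc (0 : ℝ) 1, ContinuousOn γ (Icc s 1) → (∀ t ∈ Icc s 1, ∃ i ∈ S, γ t ∈ H i) →
      ∃ m ≤ S.card, ∃ r, HingeChain H m (γ s) (γ 1) r ∧
        ENNReal.ofReal r ≤ eVariationOn γ (Icc s 1) := by
  classical
  induction S using Finset.strongInduction with
  | H S ih =>
    intro s hs hγ hcov
    obtain ⟨i, hiS, hi⟩ := hcov s (left_mem_Icc.2 hs.2)
    have hpre : ∀ A : Set E, IsClosed A → IsClosed (Icc s 1 ∩ γ ⁻¹' A) := fun A hA =>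
      hγ.preimage_isClosed_of_isClosed isClosed_Icc hA
    set T := Icc s 1 ∩ γ ⁻¹' H i with hT
    have hTcl : IsClosed T := hpre _ (hcl i)
    have hTne : T.Nonempty := ⟨s, left_mem_Icc.2 hs.2, hi⟩
    have hTbd : BddAbove T := ⟨1, fun t ht => ht.1.2⟩
    obtain ⟨hu1, hu2⟩ : sSup T ∈ T := hTcl.csSup_mem hTne hTbd
    set u := sSup T with hu
    have hlen : ENNReal.ofReal (dist (γ s) (γ u)) ≤ eVariationOn γ (Icc s u) := by
      rw [← edist_dist]
      exact eVariationOn.edist_le _ (left_mem_Icc.2 hu1.1) (right_mem_Icc.2 hu1.1)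
    rcases hu1.2.eq_or_lt with h1 | h1
    · rw [h1] at hu2 hlen
      exact ⟨1, Finset.card_pos.2 ⟨i, hiS⟩, _, HingeChain.single hi hu2, hlen⟩
    have hgt : ∀ t ∈ Ioc u 1, ∃ j ∈ S.erase i, γ t ∈ H j := by
      intro t ht
      have htI : t ∈ Icc s 1 := ⟨hu1.1.trans ht.1.le, ht.2⟩
      obtain ⟨j, hj, hjt⟩ := hcov t htI
      refine ⟨j, Finset.mem_erase.2 ⟨?_, hj⟩, hjt⟩
      rintro rfl
      exact absurd (le_csSup hTbd ⟨htI, hjt⟩) (not_le.2 ht.1)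
    have hcl' : IsClosed (Icc s 1 ∩ γ ⁻¹' (⋃ j ∈ S.erase i, H j)) :=
      hpre _ (isClosed_biUnion_finset fun j _ => hcl j)
    have hsub : Ioc u 1 ⊆ Icc s 1 ∩ γ ⁻¹' (⋃ j ∈ S.erase i, H j) := fun t ht =>
      ⟨⟨hu1.1.trans ht.1.le, ht.2⟩, by simpa using hgt t ht⟩
    have hsub' : Icc u 1 ⊆ Icc s 1 ∩ γ ⁻¹' (⋃ j ∈ S.erase i, H j) := by
      rw [← closure_Ioc h1.ne]
      exact closure_minimal hsub hcl'
    obtain ⟨m, hm, r, hch, hr⟩ := ih (S.erase i) (Finset.erase_ssubset hiS) u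
      ⟨hs.1.trans hu1.1, hu1.2⟩ (hγ.mono (Icc_subset_Icc_left hu1.1)) (fun t ht => by
        simpa using (hsub' ht).2)
    refine ⟨m + 1, ?_, _, HingeChain.cons hi hu2 hch, ?_⟩
    · rw [Finset.card_erase_of_mem hiS] at hm
      have := Finset.card_pos.2 ⟨i, hiS⟩
      omega
    · have h3 := eVariationOn.Icc_add_Icc γ (s := univ) hu1.1 hu1.2 (mem_univ _)
      simp only [univ_inter] at h3
      rw [← h3, ENNReal.ofReal_add dist_nonneg (dist_nonneg.trans hch.dist_le)]
      exact add_le_add hlen hr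

theorem isClosed_setOf_hingeChain [FiniteDimensional ℝ E] [Finite ι] {H : ι → Set E}
    (hcl : ∀ i, IsClosed (H i)) (b : E) (m : ℕ) :
    IsClosed {p : E × ℝ | HingeChain H m p.1 b p.2} := by
  have := FiniteDimensional.proper ℝ E
  induction m with
  | zero =>
    convert isClosed_empty
    rw [eq_empty_iff_forall_notMem]
    intro p hp
    exact absurd (HingeChain.one_le hp) (by norm_num)
  | succ m ih =>
    have e : {p : E × ℝ | HingeChain H (m + 1) p.1 b p.2} =
        (⋃ i, {p : E × ℝ | m = 0 ∧ p.1 ∈ H i ∧ b ∈ H i ∧ p.2 = dist p.1 b}) ∪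
        ⋃ i, {p : E × ℝ | p.1 ∈ H i ∧ ∃ z ∈ H i, HingeChain H m z b (p.2 - dist p.1 z)} := by
      ext ⟨a, r⟩
      simp only [mem_ofPred_eq, mem_union, mem_iUnion]
      constructor
      · intro h
        generalize hm' : m + 1 = m' at h
        cases h with
        | single ha hb => exact Or.inl ⟨_, by omega, ha, hb, rfl⟩
        | @cons i m'' _ z _ r ha hz h =>
          obtain rfl : m = m'' := by omega
          exact Or.inr ⟨i, ha, z, hz, by simpa using h⟩
      · rintro (⟨i, rfl, ha, hb, rfl⟩ | ⟨i, ha, z, hz, h⟩)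
        · exact HingeChain.single ha hb
        · simpa using HingeChain.cons ha hz h
    rw [e]
    refine IsClosed.union (isClosed_iUnion_of_finite fun i => ?_)
      (isClosed_iUnion_of_finite fun i => ?_)
    · by_cases hm : m = 0 ∧ b ∈ H i
      · simp only [hm.1, hm.2, true_and]
        exact ((hcl i).preimage continuous_fst).inter (isClosed_eq continuous_snd (by fun_prop))
      · convert isClosed_empty
        rw [eq_empty_iff_forall_notMem]
        rintro p ⟨h1, -, h2, -⟩
        exact hm ⟨h1, h2⟩
    · refine IsSeqClosed.isClosed fun x p hx hp => ?_
      choose hxa z hz hch using hx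
      have h1 : Tendsto (fun n => (x n).1) atTop (𝓝 p.1) := (continuous_fst.tendsto p).comp hp
      have h2 : Tendsto (fun n => (x n).2) atTop (𝓝 p.2) := (continuous_snd.tendsto p).comp hp
      have hbd : Bornology.IsBounded (range z) := by
        obtain ⟨K, hK⟩ := (Metric.isBounded_range_of_tendsto _ h2).exists_norm_le
        refine (Metric.isBounded_closedBall (x := b) (r := K)).subset ?_
        rintro _ ⟨n, rfl⟩
        have h3 := (hch n).dist_le
        have h4 := hK _ (mem_range_self n)
        rw [Real.norm_eq_abs] at h4
        rw [Metric.mem_closedBall]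
        linarith [le_abs_self (x n).2, dist_nonneg (x := (x n).1) (y := z n)]
      obtain ⟨w, -, φ, hφ, hw⟩ := tendsto_subseq_of_bounded hbd (fun n => mem_range_self n)
      have h1' := h1.comp hφ.tendsto_atTop
      have h2' := h2.comp hφ.tendsto_atTop
      refine ⟨(hcl i).mem_of_tendsto h1 (Eventually.of_forall hxa), w,
        (hcl i).mem_of_tendsto hw (Eventually.of_forall fun n => hz _), ?_⟩
      exact ih.mem_of_tendsto (hw.prodMk_nhds (h2'.sub (h1'.dist hw)))
        (Eventually.of_forall fun n => hch (φ n))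

end HingeChainExistence

section PolyhedralDistance

open Filter Topology
open scoped RealInnerProductSpace

variable {E : Type*} [NormedAddCommGroup E] [InnerProductSpace ℝ E] [FiniteDimensional ℝ E]
  {ι : Type*} [Finite ι]

theorem exists_minimalChain (ν : ι → E) (c : ι → ℝ) {a b : E} (ha : ∀ i, ⟪ν i, a⟫ ≤ c i)
    (hb : ∀ i, ⟪ν i, b⟫ ≤ c i) (hfin : intrinsicEDist {x | ∃ i, c i ≤ ⟪ν i, x⟫} a b ≠ ⊤) :
    ∃ m r, HingeChain (fun i => {x | ⟪ν i, x⟫ = c i}) m a b r ∧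
      IsMinimalChain (fun i => {x | ⟪ν i, x⟫ = c i}) m a b r ∧
      intrinsicDist {x | ∃ i, c i ≤ ⟪ν i, x⟫} a b = r := by
  classical
  cases nonempty_fintype ι
  set H : ι → Set E := fun i => {x | ⟪ν i, x⟫ = c i} with hH
  set Ω : Set E := {x | ∃ i, c i ≤ ⟪ν i, x⟫} with hΩ
  set P : Set E := {x | ∀ i, ⟪ν i, x⟫ ≤ c i} with hP
  have hHcl : ∀ i, IsClosed (H i) := fun i => isClosed_eq (by fun_prop) (by fun_prop)
  have hHconv : ∀ i, Convex ℝ (H i) := fun i =>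
    convex_hyperplane (f := fun x => ⟪ν i, x⟫) (innerₛₗ ℝ (ν i)).isLinear (c i)
  have hPe : P = ⋂ i, {x | ⟪ν i, x⟫ ≤ c i} := by ext; simp [hP]
  have hPcl : IsClosed P := by
    rw [hPe]; exact isClosed_iInter fun i => isClosed_le (by fun_prop) (by fun_prop)
  have hPconv : Convex ℝ P := by
    rw [hPe]
    exact convex_iInter fun i =>
      convex_halfSpace_le (f := fun x => ⟪ν i, x⟫) (innerₛₗ ℝ (ν i)).isLinear (c i)
  have hUo : IsOpen {x : E | ∀ i, ⟪ν i, x⟫ < c i} := by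
    rw [ofPred_forall]
    exact isOpen_iInter_of_finite fun i => isOpen_lt (by fun_prop) (by fun_prop)
  have hPne : P.Nonempty := ⟨a, ha⟩
  obtain ⟨π, hπL, hπP, hπid, hπU⟩ := exists_metricProjection hPne hPcl.isComplete hPconv
  have hHΩ : ∀ i, H i ⊆ Ω := fun i x hx => ⟨i, ge_of_eq hx⟩
  have hchain_le : ∀ {m r}, HingeChain H m a b r → intrinsicEDist Ω a b ≤ ENNReal.ofReal r :=
    fun h => h.intrinsicEDist_le hHconv hHΩ
  have hcurve : ∀ γ : ℝ → E, ContinuousOn γ (Icc 0 1) → γ 0 = a → γ 1 = b →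
      MapsTo γ (Icc 0 1) Ω → ∃ m ≤ Fintype.card ι, ∃ r, HingeChain H m a b r ∧
        ENNReal.ofReal r ≤ eVariationOn γ (Icc 0 1) := by
    intro γ hγ h0 h1 hm
    obtain ⟨m, hm, r, hch, hr⟩ := exists_hingeChain_le_eVariationOn hHcl (γ := π ∘ γ)
      Finset.univ 0 (by simp) (hπL.continuous.comp_continuousOn hγ) (fun t ht => by
        obtain ⟨i, hi⟩ := hm ht
        have h2 := hπU _ hUo (fun x hx i => (hx i).le) (γ t) (fun h => absurd (h i) (not_lt.2 hi))
        simp only [mem_ofPred_eq, not_forall, not_lt] at h2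
        obtain ⟨j, hj⟩ := h2
        exact ⟨j, Finset.mem_univ j, le_antisymm (hπP (γ t) j) hj⟩)
    refine ⟨m, hm, r, ?_, hr.trans ?_⟩
    · simpa [h0, h1, hπid a ha, hπid b hb] using hch
    · simpa using (hπL.lipschitzOnWith (s := univ)).comp_eVariationOn_le (mapsTo_univ γ (Icc 0 1))
  set Λ : Set ℝ := ⋃ m : Fin (Fintype.card ι + 1), {r | HingeChain H m a b r} with hΛ
  have hΛcl : IsClosed Λ := isClosed_iUnion_of_finite fun m =>
    (isClosed_setOf_hingeChain hHcl b m).preimage (by fun_prop : Continuous fun r : ℝ => (a, r))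
  have hΛmem : ∀ {m r}, m ≤ Fintype.card ι → HingeChain H m a b r → r ∈ Λ := fun {m r} hm h =>
    mem_iUnion.2 ⟨⟨m, by omega⟩, h⟩
  have hΛbd : BddBelow Λ := ⟨0, fun r hr => by
    obtain ⟨m, hm⟩ := mem_iUnion.1 hr
    exact dist_nonneg.trans (HingeChain.dist_le hm)⟩
  have hΛne : Λ.Nonempty := by
    by_contra hne
    apply hfin
    rw [eq_top_iff]
    refine le_intrinsicEDist fun γ h1 h2 h3 h4 => ?_
    obtain ⟨m, hm, r, hch, -⟩ := hcurve γ h1 h2 h3 h4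
    exact absurd ⟨r, hΛmem hm hch⟩ hne
  have hmin := hΛcl.csInf_mem hΛne hΛbd
  set r := sInf Λ with hr
  obtain ⟨m₀, hm₀⟩ := mem_iUnion.1 hmin
  have hex : ∃ m, HingeChain H m a b r := ⟨_, hm₀⟩
  have hr0 : 0 ≤ r := dist_nonneg.trans (HingeChain.dist_le hm₀)
  have hD : intrinsicEDist Ω a b = ENNReal.ofReal r := by
    refine le_antisymm (hchain_le hm₀) (le_intrinsicEDist fun γ h1 h2 h3 h4 => ?_)
    obtain ⟨m, hm, r', hch, hr'⟩ := hcurve γ h1 h2 h3 h4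
    exact (ENNReal.ofReal_le_ofReal (csInf_le hΛbd (hΛmem hm hch))).trans hr'
  refine ⟨Nat.find hex, r, Nat.find_spec hex, ⟨fun m' r' h => ?_, fun m' h => Nat.find_min' hex h⟩,
    ?_⟩
  · have := hchain_le h
    rw [hD] at this
    exact (ENNReal.ofReal_le_ofReal_iff (dist_nonneg.trans h.dist_le)).1 this
  · change (intrinsicEDist Ω a b).toReal = r
    rw [hD, ENNReal.toReal_ofReal hr0]

/-- The exterior distance of two boundary points of a polyhedron is locally bounded, along
supporting hyperplanes, by the Euclidean distance in a development. -/
theorem exists_local_development (ν : ι → E) (c : ι → ℝ) {a b : E} (ha : ∀ i, ⟪ν i, a⟫ ≤ c i)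
    (hb : ∀ i, ⟪ν i, b⟫ ≤ c i) (ha' : ∃ i, ⟪ν i, a⟫ = c i)
    (hfin : intrinsicEDist {x | ∃ i, c i ≤ ⟪ν i, x⟫} a b ≠ ⊤) :
    ∃ (i j : ι) (v : E) (R : E ≃ₗᵢ[ℝ] E), ⟪ν i, a⟫ = c i ∧ ⟪ν j, b⟫ = c j ∧
      ‖v‖ = intrinsicDist {x | ∃ i, c i ≤ ⟪ν i, x⟫} a b ∧
      ∀ᶠ q : E × E in 𝓝 (0, 0), ⟪ν i, q.1⟫ = 0 → ⟪ν j, q.2⟫ = 0 →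
        intrinsicDist {x | ∃ i, c i ≤ ⟪ν i, x⟫} (a + q.1) (b + q.2) ≤ ‖v + R q.2 - q.1‖ := by
  set Ω : Set E := {x | ∃ i, c i ≤ ⟪ν i, x⟫} with hΩ
  have hHconv : ∀ i, Convex ℝ {x | ⟪ν i, x⟫ = c i} := fun i =>
    convex_hyperplane (f := fun x => ⟪ν i, x⟫) (innerₛₗ ℝ (ν i)).isLinear (c i)
  have hHΩ : ∀ i, {x | ⟪ν i, x⟫ = c i} ⊆ Ω := fun i x hx => ⟨i, ge_of_eq hx⟩
  have hch : ∀ {m r x y}, HingeChain (fun i => {x | ⟪ν i, x⟫ = c i}) m x y r →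
      intrinsicDist Ω x y ≤ r := fun h =>
    ENNReal.toReal_le_of_le_ofReal (dist_nonneg.trans h.dist_le)
      (h.intrinsicEDist_le hHconv hHΩ)
  rcases eq_or_ne a b with rfl | hab
  · obtain ⟨i, hi⟩ := ha'
    refine ⟨i, i, 0, LinearIsometryEquiv.refl ℝ E, hi, hi, ?_, Eventually.of_forall ?_⟩
    · have h1 := hch (HingeChain.single (H := fun i => {x | ⟪ν i, x⟫ = c i}) (i := i) hi hi)
      rw [dist_self] at h1
      rw [norm_zero]
      exact le_antisymm ENNReal.toReal_nonneg h1
    · intro q h1 h2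
      refine (hch (HingeChain.single (i := i) ?_ ?_)).trans_eq ?_
      · simpa [inner_add_right, h1] using hi
      · simpa [inner_add_right, h2] using hi
      · rw [dist_comm, dist_eq_norm]
        simp
  · obtain ⟨m, r, h, hmin, hr⟩ := exists_minimalChain ν c ha hb hfin
    obtain ⟨i, j, p, R, h1, h2, h3, h4, -, -, h6⟩ := h.exists_development hmin hab
    refine ⟨i, j, (r / dist a p) • (p - a), R, h1, h4, ?_, h6.mono fun q hq hq1 hq2 => ?_⟩
    · rw [hr, norm_smul, ← dist_eq_norm, dist_comm p a, norm_div,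
        Real.norm_of_nonneg dist_nonneg, div_mul_cancel₀ _ (dist_ne_zero.2 h3),
        Real.norm_of_nonneg (dist_nonneg.trans h.dist_le)]
    · obtain ⟨r', hr', hc⟩ := hq hq1 hq2
      exact (hch hc).trans hr'

end PolyhedralDistance

section ConcavityCriterion

open Filter Topology

/-- A continuous function on `[0,1]` with nonpositive second differences at small scales lies above
its chord. -/
theorem chord_le_of_eventually_midpoint_le {ψ : ℝ → ℝ} (hψ : ContinuousOn ψ (Icc 0 1))
    (hmid : ∀ t ∈ Ioo (0 : ℝ) 1, ∀ᶠ s in 𝓝[>] (0 : ℝ), ψ (t + s) + ψ (t - s) ≤ 2 * ψ t)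
    {t : ℝ} (ht : t ∈ Icc (0 : ℝ) 1) : (1 - t) * ψ 0 + t * ψ 1 ≤ ψ t := by
  set u : ℝ → ℝ := fun t => ψ t - ((1 - t) * ψ 0 + t * ψ 1) with hu
  have huc : ContinuousOn u (Icc 0 1) := hψ.sub (by fun_prop)
  obtain ⟨m, hm, hmin⟩ := isCompact_Icc.exists_isMinOn ⟨t, ht⟩ huc
  suffices 0 ≤ u m by
    have := hmin ht
    simp only [hu, mem_ofPred_eq] at *
    linarith
  by_contra! hneg
  set S := Icc (0 : ℝ) 1 ∩ u ⁻¹' {u m} with hS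
  have hScl : IsClosed S := huc.preimage_isClosed_of_isClosed isClosed_Icc isClosed_singleton
  have hSbd : BddBelow S := ⟨0, fun x hx => hx.1.1⟩
  obtain ⟨h1, h2⟩ : sInf S ∈ S := hScl.csInf_mem ⟨m, hm, rfl⟩ hSbd
  set p := sInf S with hp
  have h2' : u p = u m := h2
  have hp0 : p ≠ 0 := by rintro h; rw [h] at h2'; simp [hu] at h2' hneg; linarith
  have hp1 : p ≠ 1 := by rintro h; rw [h] at h2'; simp [hu] at h2' hneg; linarith
  have hpI : p ∈ Ioo (0 : ℝ) 1 := ⟨lt_of_le_of_ne h1.1 hp0.symm, lt_of_le_of_ne h1.2 hp1⟩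
  have hsm : ∀ᶠ s in 𝓝[>] (0 : ℝ), s ∈ Ioo 0 (min p (1 - p)) :=
    Ioo_mem_nhdsGT (lt_min hpI.1 (by linarith [hpI.2]))
  obtain ⟨s, hs, hs', hs''⟩ := ((hmid p hpI).and hsm).exists
  have hs1 := hs''.trans_le (min_le_left _ _)
  have hs2 := hs''.trans_le (min_le_right _ _)
  have hm1 : u m ≤ u (p + s) := hmin ⟨by linarith, by linarith⟩
  have hI : p - s ∈ Icc (0 : ℝ) 1 := ⟨by linarith, by linarith⟩
  have hm2 : u m < u (p - s) := by
    refine lt_of_le_of_ne (hmin hI) fun h => ?_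
    have := csInf_le hSbd (show p - s ∈ S from ⟨hI, h.symm⟩)
    linarith
  have : u (p + s) + u (p - s) ≤ 2 * u p := by
    simp only [hu]
    linarith
  linarith

end ConcavityCriterion

section IntrinsicDistMetric

variable {E : Type*} [NormedAddCommGroup E] [NormedSpace ℝ E]

theorem intrinsicDist_triangle {X : Set E} (hfin : ∀ x ∈ X, ∀ y ∈ X, intrinsicEDist X x y ≠ ⊤)
    {a b c : E} (ha : a ∈ X) (hb : b ∈ X) (hc : c ∈ X) :
    intrinsicDist X a c ≤ intrinsicDist X a b + intrinsicDist X b c :=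
  (ENNReal.toReal_mono (ENNReal.add_ne_top.2 ⟨hfin a ha b hb, hfin b hb c hc⟩)
    (intrinsicEDist_triangle X a b c)).trans
    (ENNReal.toReal_add (hfin a ha b hb) (hfin b hb c hc)).le

theorem intrinsicDist_le_dist {X : Set E} {a b : E} (h : segment ℝ a b ⊆ X) :
    intrinsicDist X a b ≤ dist a b :=
  ENNReal.toReal_le_of_le_ofReal dist_nonneg
    ((intrinsicEDist_le_edist h).trans_eq (edist_dist a b))

theorem intrinsicDist_nonneg (X : Set E) (a b : E) : 0 ≤ intrinsicDist X a b :=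
  ENNReal.toReal_nonneg

end IntrinsicDistMetric

section PolyhedralGraph

open Filter Topology
open scoped RealInnerProductSpace

variable {E : Type*} [NormedAddCommGroup E] [InnerProductSpace ℝ E] {ι : Type*}

/-- Over the segment `x + t h`, `t ∈ [0,1]`, the function `φ` is the height (in the direction `e`)
of the lower boundary of the polyhedron `{z | ∀ i, ⟪ν i, z⟫ ≤ c i}`, whose slopes are controlled by
the constant `L`. -/
structure IsLowerGraph (ν : ι → E) (c : ι → ℝ) (e x h : E) (L : ℝ) (φ : ℝ → ℝ) : Prop where
  norm_eq : ‖e‖ = 1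
  continuous : Continuous φ
  exists_eq : ∀ t, ∃ j, ⟪ν j, x + t • h + φ t • e⟫ = c j ∧ ⟪ν j, e⟫ < 0
  le_of_neg : ∀ t i, ⟪ν i, e⟫ < 0 → ⟪ν i, x + t • h + φ t • e⟫ ≤ c i
  le : ∀ t ∈ Icc (0 : ℝ) 1, ∀ i, ⟪ν i, x + t • h + φ t • e⟫ ≤ c i
  neg_of_eq : ∀ t ∈ Icc (0 : ℝ) 1, ∀ i, ⟪ν i, x + t • h + φ t • e⟫ = c i → ⟪ν i, e⟫ < 0
  norm_sq_le : ∀ t ∈ Icc (0 : ℝ) 1, ∀ i, ⟪ν i, x + t • h + φ t • e⟫ = c i →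
    ∀ σ : ℝ, ⟪ν i, h + σ • e⟫ = 0 → ‖h + σ • e‖ ^ 2 ≤ 2 * (1 + L ^ 2) * ‖h‖ ^ 2

namespace IsLowerGraph

variable {ν : ι → E} {c : ι → ℝ} {e x h : E} {L : ℝ} {φ : ℝ → ℝ}

theorem mem_exterior (hφ : IsLowerGraph ν c e x h L φ) (t : ℝ) :
    x + t • h + φ t • e ∈ {z | ∃ i, c i ≤ ⟪ν i, z⟫} := by
  obtain ⟨j, hj, -⟩ := hφ.exists_eq t
  exact ⟨j, hj.ge⟩

theorem exists_slope (hφ : IsLowerGraph ν c e x h L φ) {t : ℝ} (ht : t ∈ Icc (0 : ℝ) 1) {i : ι}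
    (hi : ⟪ν i, x + t • h + φ t • e⟫ = c i) :
    ∃ σ : ℝ, ⟪ν i, h + σ • e⟫ = 0 ∧ ‖h + σ • e‖ ^ 2 ≤ 2 * (1 + L ^ 2) * ‖h‖ ^ 2 ∧
      ∀ s, φ t + s * σ ≤ φ (t + s) ∧
        segment ℝ (x + t • h + φ t • e + s • (h + σ • e)) (x + (t + s) • h + φ (t + s) • e) ⊆
          {z | ∃ i, c i ≤ ⟪ν i, z⟫} ∧
        dist (x + t • h + φ t • e + s • (h + σ • e)) (x + (t + s) • h + φ (t + s) • e) =
          φ (t + s) - φ t - s * σ := by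
  have hne := hφ.neg_of_eq t ht i hi
  have hσ : ⟪ν i, h + (-⟪ν i, h⟫ / ⟪ν i, e⟫) • e⟫ = 0 := by
    rw [inner_add_right, inner_smul_right, div_mul_cancel₀ _ hne.ne, add_neg_cancel]
  set σ := -⟪ν i, h⟫ / ⟪ν i, e⟫ with hσd
  refine ⟨σ, hσ, hφ.norm_sq_le t ht i hi σ hσ, fun s => ?_⟩
  have e1 : x + (t + s) • h + φ (t + s) • e =
      x + t • h + φ t • e + s • (h + σ • e) + (φ (t + s) - φ t - s * σ) • e := by module
  have hle : φ t + s * σ ≤ φ (t + s) := by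
    have := hφ.le_of_neg (t + s) i hne
    rw [e1, inner_add_right, inner_add_right, hi, inner_smul_right _ _ s, hσ,
      inner_smul_right] at this
    nlinarith
  refine ⟨hle, ?_, ?_⟩
  · obtain ⟨j, hj, hj'⟩ := hφ.exists_eq (t + s)
    rw [segment_symm, segment_eq_image']
    rintro _ ⟨τ, hτ, rfl⟩
    refine ⟨j, ?_⟩
    have e2 : x + t • h + φ t • e + s • (h + σ • e) - (x + (t + s) • h + φ (t + s) • e) =
      -((φ (t + s) - φ t - s * σ) • e) := by rw [e1]; abel
    simp only [e2]
    rw [inner_add_right, hj, inner_smul_right, inner_neg_right, inner_smul_right]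
    have h1 : 0 ≤ φ (t + s) - φ t - s * σ := by linarith
    have := mul_nonneg (mul_nonneg hτ.1 h1) (neg_nonneg.2 hj'.le)
    linarith
  · rw [e1, dist_self_add_right, norm_smul, hφ.norm_eq, mul_one, Real.norm_of_nonneg]
    linarith

end IsLowerGraph

variable {ν : ι → E} {c : ι → ℝ} {e₁ e₂ x₁ x₂ h₁ h₂ : E} {L M : ℝ} {φ₁ φ₂ : ℝ → ℝ}

theorem continuousOn_intrinsicDist_lowerGraph
    (hfin : ∀ x ∈ {z | ∃ i, c i ≤ ⟪ν i, z⟫}, ∀ y ∈ {z | ∃ i, c i ≤ ⟪ν i, z⟫},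
      intrinsicEDist {z | ∃ i, c i ≤ ⟪ν i, z⟫} x y ≠ ⊤)
    (hφ₁ : IsLowerGraph ν c e₁ x₁ h₁ L φ₁) (hφ₂ : IsLowerGraph ν c e₂ x₂ h₂ L φ₂) :
    ContinuousOn (fun t => intrinsicDist {z | ∃ i, c i ≤ ⟪ν i, z⟫} (x₁ + t • h₁ + φ₁ t • e₁)
      (x₂ + t • h₂ + φ₂ t • e₂)) (Icc 0 1) := by
  set Ω := {z | ∃ i, c i ≤ ⟪ν i, z⟫} with hΩ
  have key : ∀ {e x h φ}, IsLowerGraph ν c e x h L φ → ∀ t ∈ Icc (0 : ℝ) 1,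
      ∃ η : ℝ → ℝ, Tendsto η (𝓝 t) (𝓝 0) ∧ ∀ u,
        intrinsicDist Ω (x + t • h + φ t • e) (x + u • h + φ u • e) ≤ η u ∧
        intrinsicDist Ω (x + u • h + φ u • e) (x + t • h + φ t • e) ≤ η u := by
    intro e x h φ hφ t ht
    obtain ⟨i, hi, hi'⟩ := hφ.exists_eq t
    obtain ⟨σ, hσ, -, hs⟩ := hφ.exists_slope ht hi
    refine ⟨fun u => ‖(u - t) • (h + σ • e)‖ + (φ u - φ t - (u - t) * σ), ?_, fun u => ?_⟩
    · have hc := hφ.continuous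
      have : Continuous fun u => ‖(u - t) • (h + σ • e)‖ + (φ u - φ t - (u - t) * σ) := by fun_prop
      simpa using this.tendsto t
    · obtain ⟨-, h2, h3⟩ := hs (u - t)
      rw [add_sub_cancel] at h2 h3
      set q := x + t • h + φ t • e + (u - t) • (h + σ • e) with hq
      have h4 : segment ℝ (x + t • h + φ t • e) q ⊆ Ω := by
        rw [segment_eq_image']
        rintro _ ⟨τ, hτ, rfl⟩
        refine ⟨i, ?_⟩
        simp only [hq]
        rw [inner_add_right, hi, add_sub_cancel_left, inner_smul_right, inner_smul_right, hσ]
        simp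
      have h5 : dist (x + t • h + φ t • e) q = ‖(u - t) • (h + σ • e)‖ := by
        rw [hq, dist_self_add_right]
      have m1 := hφ.mem_exterior t
      have m2 := hφ.mem_exterior u
      have m3 : q ∈ Ω := h4 (right_mem_segment _ _ _)
      constructor
      · refine (intrinsicDist_triangle hfin m1 m3 m2).trans ?_
        beta_reduce
        rw [← h3, ← h5]
        exact add_le_add (intrinsicDist_le_dist h4) (intrinsicDist_le_dist h2)
      · refine (intrinsicDist_triangle hfin m2 m3 m1).trans ?_
        rw [segment_symm] at h2 h4
        beta_reduce
        rw [← h3, ← h5, add_comm, dist_comm _ q, dist_comm q (x + u • h + φ u • e)]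
        exact add_le_add (intrinsicDist_le_dist h4) (intrinsicDist_le_dist h2)
  intro t ht
  obtain ⟨η₁, hη₁, k₁⟩ := key hφ₁ t ht
  obtain ⟨η₂, hη₂, k₂⟩ := key hφ₂ t ht
  refine ContinuousAt.continuousWithinAt ?_
  have h0 : Tendsto (fun u => η₁ u + η₂ u) (𝓝 t) (𝓝 0) := by simpa using hη₁.add hη₂
  refine tendsto_iff_dist_tendsto_zero.2 (squeeze_zero (fun _ => dist_nonneg) (fun u => ?_) h0)
  have a1 := hφ₁.mem_exterior t
  have a2 := hφ₁.mem_exterior u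
  have b1 := hφ₂.mem_exterior t
  have b2 := hφ₂.mem_exterior u
  have t1 := intrinsicDist_triangle hfin a2 a1 b2
  have t2 := intrinsicDist_triangle hfin a1 b1 b2
  have t3 := intrinsicDist_triangle hfin a1 a2 b1
  have t4 := intrinsicDist_triangle hfin a2 b2 b1
  obtain ⟨k1, k1'⟩ := k₁ u
  obtain ⟨k2, k2'⟩ := k₂ u
  rw [Real.dist_eq, abs_le]
  constructor <;> linarith

variable [FiniteDimensional ℝ E] [Finite ι]

/-- Concavity of the corrected squared exterior distance of a polyhedron. -/
theorem chord_le_sq_intrinsicDist_lowerGraph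
    (hfin : ∀ x ∈ {z | ∃ i, c i ≤ ⟪ν i, z⟫}, ∀ y ∈ {z | ∃ i, c i ≤ ⟪ν i, z⟫},
      intrinsicEDist {z | ∃ i, c i ≤ ⟪ν i, z⟫} x y ≠ ⊤)
    (hφ₁ : IsLowerGraph ν c e₁ x₁ h₁ L φ₁) (hφ₂ : IsLowerGraph ν c e₂ x₂ h₂ L φ₂)
    (hM : ∀ t ∈ Icc (0 : ℝ) 1, intrinsicDist {z | ∃ i, c i ≤ ⟪ν i, z⟫} (x₁ + t • h₁ + φ₁ t • e₁)
      (x₂ + t • h₂ + φ₂ t • e₂) < 2 * M)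
    {ψ : ℝ → ℝ} (hψ : ψ = fun t => intrinsicDist {z | ∃ i, c i ≤ ⟪ν i, z⟫}
      (x₁ + t • h₁ + φ₁ t • e₁) (x₂ + t • h₂ + φ₂ t • e₂) ^ 2
        - 4 * (1 + L ^ 2) * (‖x₁ + t • h₁‖ ^ 2 + ‖x₂ + t • h₂‖ ^ 2) - 4 * M * (φ₁ t + φ₂ t))
    {t : ℝ} (ht : t ∈ Icc (0 : ℝ) 1) : (1 - t) * ψ 0 + t * ψ 1 ≤ ψ t := by
  have hc₁ := hφ₁.continuous
  have hc₂ := hφ₂.continuous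
  refine chord_le_of_eventually_midpoint_le ?_ ?_ ht
  · rw [hψ]
    exact (((continuousOn_intrinsicDist_lowerGraph hfin hφ₁ hφ₂).pow 2).sub (by fun_prop)).sub
      (by fun_prop)
  clear ht t
  intro t ht'
  have ht := Ioo_subset_Icc_self ht'
  set Ω := {z | ∃ i, c i ≤ ⟪ν i, z⟫} with hΩ
  set a : ℝ → E := fun t => x₁ + t • h₁ + φ₁ t • e₁ with ha
  set b : ℝ → E := fun t => x₂ + t • h₂ + φ₂ t • e₂ with hb
  obtain ⟨i, j, v, R, hi, hj, hv, hev⟩ := exists_local_development ν c (hφ₁.le t ht) (hφ₂.le t ht)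
    ((hφ₁.exists_eq t).imp fun _ h => h.1) (hfin _ (hφ₁.mem_exterior t) _ (hφ₂.mem_exterior t))
  obtain ⟨σ₁, hσ₁, hn₁, hs₁⟩ := hφ₁.exists_slope ht hi
  obtain ⟨σ₂, hσ₂, hn₂, hs₂⟩ := hφ₂.exists_slope ht hj
  set k₁ := h₁ + σ₁ • e₁ with hk₁
  set k₂ := h₂ + σ₂ • e₂ with hk₂
  set w := R k₂ - k₁ with hw
  set Δ : ℝ → ℝ := fun s => (φ₁ (t + s) - φ₁ t - s * σ₁) + (φ₂ (t + s) - φ₂ t - s * σ₂) with hΔ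
  set D : ℝ → ℝ := fun u => intrinsicDist Ω (a u) (b u) with hD
  have hΔ0 : ∀ s, 0 ≤ Δ s := fun s => by
    have := (hs₁ s).1
    have := (hs₂ s).1
    simp only [hΔ]
    linarith
  have hvD : ‖v‖ = D t := hv
  -- the local bound for the exterior distance
  have hloc : ∀ᶠ s in 𝓝 (0 : ℝ), D (t + s) ≤ Δ s + ‖v + s • w‖ := by
    have hcont : Tendsto (fun s : ℝ => (s • k₁, s • k₂)) (𝓝 0) (𝓝 (0, 0)) := by
      have : Continuous fun s : ℝ => (s • k₁, s • k₂) := by fun_prop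
      simpa using this.tendsto 0
    refine (hcont.eventually hev).mono fun s hs => ?_
    have hs' := hs (by simp only [inner_smul_right, hσ₁, mul_zero])
      (by simp only [inner_smul_right, hσ₂, mul_zero])
    obtain ⟨-, g1, g2⟩ := hs₁ s
    obtain ⟨-, g3, g4⟩ := hs₂ s
    have m1 := hφ₁.mem_exterior (t + s)
    have m2 := hφ₂.mem_exterior (t + s)
    have m3 := g1 (left_mem_segment _ _ _)
    have m4 := g3 (left_mem_segment _ _ _)
    have t1 := intrinsicDist_triangle hfin m1 m3 m2
    have t2 := intrinsicDist_triangle hfin m3 m4 m2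
    have t3 := intrinsicDist_le_dist ((segment_symm ℝ _ _).trans_subset g1)
    have t4 := intrinsicDist_le_dist g3
    rw [dist_comm, g2] at t3
    rw [g4] at t4
    have e1 : v + R (s • k₂) - s • k₁ = v + s • w := by
      rw [map_smul, hw, smul_sub]
      abel
    rw [e1] at hs'
    simp only [hD, hΔ, ha, hb]
    simp only at hs'
    linarith
  have hsmall : ∀ᶠ s in 𝓝 (0 : ℝ), 2 * ‖v + s • w‖ + Δ s < 4 * M := by
    have : Continuous fun s : ℝ => 2 * ‖v + s • w‖ + Δ s := by
      simp only [hΔ]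
      fun_prop
    refine (this.tendsto 0).eventually_lt_const ?_
    have := hM t ht
    simp only [hΔ, zero_smul, add_zero, zero_mul, sub_self]
    rw [hvD]
    simp only [hD, ha, hb]
    linarith
  have hboth := hloc.and hsmall
  have hneg : Tendsto (fun s : ℝ => -s) (𝓝 0) (𝓝 0) := by
    simpa using (continuous_neg (G := ℝ)).tendsto 0
  refine ((hboth.and (hneg.eventually hboth)).filter_mono nhdsWithin_le_nhds).mono ?_
  rintro s ⟨⟨p1, p2⟩, q1, q2⟩
  have sqb : ∀ u, D (t + u) ≤ Δ u + ‖v + u • w‖ → 2 * ‖v + u • w‖ + Δ u < 4 * M →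
      D (t + u) ^ 2 ≤ ‖v + u • w‖ ^ 2 + 4 * M * Δ u := by
    intro u h1 h2
    have h3 := pow_le_pow_left₀ (intrinsicDist_nonneg _ _ _) h1 2
    have h4 := mul_le_mul_of_nonneg_right h2.le (hΔ0 u)
    calc _ ≤ _ := h3
      _ = ‖v + u • w‖ ^ 2 + (2 * ‖v + u • w‖ + Δ u) * Δ u := by ring
      _ ≤ _ := by linarith
  have s1 := sqb s p1 p2
  have s2 := sqb (-s) q1 q2
  have par : ∀ p q : E, ‖p + s • q‖ ^ 2 + ‖p + (-s) • q‖ ^ 2 = 2 * ‖p‖ ^ 2 + 2 * s ^ 2 * ‖q‖ ^ 2 := by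
    intro p q
    have := parallelogram_law_with_norm ℝ p (s • q)
    rw [neg_smul, ← sub_eq_add_neg]
    rw [norm_smul] at this
    have h5 : (‖s‖ * ‖q‖) ^ 2 = s ^ 2 * ‖q‖ ^ 2 := by
      rw [Real.norm_eq_abs, mul_pow, sq_abs]
    rw [h5] at this
    linarith
  have hwn : ‖w‖ ^ 2 ≤ 4 * (1 + L ^ 2) * (‖h₁‖ ^ 2 + ‖h₂‖ ^ 2) := by
    have h1 := parallelogram_law_with_norm ℝ (R k₂) k₁
    rw [R.norm_map] at h1
    have h2 := sq_nonneg ‖R k₂ + k₁‖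
    rw [← hw] at h1
    nlinarith
  have hws := mul_le_mul_of_nonneg_left hwn (sq_nonneg s)
  have P1 := par v w
  have P2 := par (x₁ + t • h₁) h₁
  have P3 := par (x₂ + t • h₂) h₂
  have E1 : ∀ u (x h : E), x + (t + u) • h = x + t • h + u • h := fun u x h => by module
  rw [← E1, ← E1] at P2 P3
  have hψ' : ∀ u, ψ u = D u ^ 2 - 4 * (1 + L ^ 2) * (‖x₁ + u • h₁‖ ^ 2 + ‖x₂ + u • h₂‖ ^ 2)
      - 4 * M * (φ₁ u + φ₂ u) := fun u => by rw [hψ]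
  rw [hψ', hψ', hψ', sub_eq_add_neg t s, ← hvD]
  have hΔs : Δ s + Δ (-s) = (φ₁ (t + s) + φ₂ (t + s)) + (φ₁ (t + -s) + φ₂ (t + -s))
      - 2 * (φ₁ t + φ₂ t) := by
    simp only [hΔ]; ring
  have hΔM : 4 * M * Δ s + 4 * M * Δ (-s) = 4 * M * (φ₁ (t + s) + φ₂ (t + s)) +
      4 * M * (φ₁ (t + -s) + φ₂ (t + -s)) - 2 * (4 * M * (φ₁ t + φ₂ t)) := by
    rw [← mul_add, hΔs]; ring
  have hN : 4 * (1 + L ^ 2) * (‖x₁ + (t + s) • h₁‖ ^ 2 + ‖x₂ + (t + s) • h₂‖ ^ 2) +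
      4 * (1 + L ^ 2) * (‖x₁ + (t + -s) • h₁‖ ^ 2 + ‖x₂ + (t + -s) • h₂‖ ^ 2) =
      2 * (4 * (1 + L ^ 2) * (‖x₁ + t • h₁‖ ^ 2 + ‖x₂ + t • h₂‖ ^ 2)) +
      2 * (s ^ 2 * (4 * (1 + L ^ 2) * (‖h₁‖ ^ 2 + ‖h₂‖ ^ 2))) := by
    linear_combination 4 * (1 + L ^ 2) * (P2 + P3)
  linarith

end PolyhedralGraph

section ExteriorDistance

open scoped RealInnerProductSpace

variable {E : Type*} [NormedAddCommGroup E] [InnerProductSpace ℝ E]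

theorem exists_norm_eq_inner_eq_zero [FiniteDimensional ℝ E] (hE : 2 ≤ Module.finrank ℝ E)
    (p : E) {r : ℝ} (hr : 0 ≤ r) : ∃ w : E, ‖w‖ = r ∧ ⟪p, w⟫ = 0 := by
  have h : LinearMap.ker (innerₛₗ ℝ p) ≠ ⊥ :=
    LinearMap.ker_ne_bot_of_finrank_lt (by rw [Module.finrank_self]; omega)
  obtain ⟨w, hw, hw0⟩ := Submodule.exists_mem_ne_zero_of_ne_bot h
  have hw' : ⟪p, w⟫ = 0 := hw
  refine ⟨(r / ‖w‖) • w, ?_, by rw [inner_smul_right, hw', mul_zero]⟩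
  rw [norm_smul, norm_div, norm_norm, div_mul_cancel₀ _ (norm_ne_zero_iff.2 hw0),
    Real.norm_of_nonneg hr]

theorem segment_subset_compl_of_inner_nonneg {U : Set E} {c₀ : E} {R : ℝ}
    (hU : U ⊆ Metric.closedBall c₀ R) (hR : 0 < R) {p q : E} (hp : ‖p‖ = 2 * R) (hq : ‖q‖ = 2 * R)
    (hpq : 0 ≤ ⟪p, q⟫) : segment ℝ (c₀ + p) (c₀ + q) ⊆ Uᶜ := by
  rintro _ ⟨s, t, hs, ht, hst, rfl⟩ hx
  have h1 := hU hx
  have e : s • (c₀ + p) + t • (c₀ + q) - c₀ = s • p + t • q := by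
    rw [← eq_sub_iff_add_eq'] at hst
    rw [hst]
    module
  rw [mem_closedBall_iff_norm, e] at h1
  have h2 := norm_add_sq_real (s • p) (t • q)
  rw [norm_smul, norm_smul, Real.norm_of_nonneg hs, Real.norm_of_nonneg ht, hp, hq,
    real_inner_smul_left, inner_smul_right] at h2
  have h3 := mul_nonneg hs (mul_nonneg ht hpq)
  have h4 := pow_le_pow_left₀ (norm_nonneg _) h1 2
  have h5 : 1 ≤ 2 * (s ^ 2 + t ^ 2) := by nlinarith [sq_nonneg (s - t)]
  nlinarith [sq_pos_of_pos hR]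

theorem segment_subset_compl_of_convex {U : Set E} (hU : Convex ℝ U) {c₀ a : E} (hc₀ : c₀ ∈ U)
    (ha : a ∉ U) {s : ℝ} (hs : 1 ≤ s) : segment ℝ a (c₀ + s • (a - c₀)) ⊆ Uᶜ := by
  rw [segment_eq_image']
  rintro _ ⟨t, ht, rfl⟩ hx
  apply ha
  set u := 1 + t * (s - 1) with hu
  have hu1 : 1 ≤ u := by
    have := mul_nonneg ht.1 (sub_nonneg.2 hs)
    linarith
  have e : a + t • (c₀ + s • (a - c₀) - a) = c₀ + u • (a - c₀) := by rw [hu]; module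
  simp only [e] at hx
  have h := hU.add_smul_sub_mem hc₀ hx (t := u⁻¹)
    ⟨by positivity, inv_le_one_of_one_le₀ hu1⟩
  rwa [add_sub_cancel_left, smul_smul, inv_mul_cancel₀ (by positivity), one_smul,
    add_sub_cancel] at h

theorem intrinsicEDist_compl_le [FiniteDimensional ℝ E] (hE : 2 ≤ Module.finrank ℝ E) {U : Set E}
    (hUc : Convex ℝ U) {c₀ : E} (hc₀ : c₀ ∈ U) {R : ℝ} (hU : U ⊆ Metric.closedBall c₀ R)
    {a b : E} (ha : a ∉ U) (hb : b ∉ U) (haR : ‖a - c₀‖ ≤ R) (hbR : ‖b - c₀‖ ≤ R) :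
    intrinsicEDist Uᶜ a b ≤ ENNReal.ofReal (12 * R) := by
  have radial : ∀ a ∉ U, ‖a - c₀‖ ≤ R → 0 < R ∧ ∃ p : E, ‖p‖ = 2 * R ∧
      segment ℝ a (c₀ + p) ⊆ Uᶜ ∧ dist a (c₀ + p) ≤ 2 * R := by
    intro a ha haR
    have hne : a - c₀ ≠ 0 := fun h => ha (by rwa [sub_eq_zero.1 h])
    have hpos := norm_pos_iff.2 hne
    have hR : 0 < R := hpos.trans_le haR
    have hs : 1 ≤ 2 * R / ‖a - c₀‖ := by rw [le_div_iff₀ hpos]; linarith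
    refine ⟨hR, (2 * R / ‖a - c₀‖) • (a - c₀), ?_, segment_subset_compl_of_convex hUc hc₀ ha hs, ?_⟩
    · rw [norm_smul, norm_div, norm_norm, div_mul_cancel₀ _ hpos.ne',
        Real.norm_of_nonneg (by positivity)]
    · have e : c₀ + (2 * R / ‖a - c₀‖) • (a - c₀) - a = (2 * R / ‖a - c₀‖ - 1) • (a - c₀) := by
        module
      rw [dist_comm, dist_eq_norm, e, norm_smul, Real.norm_of_nonneg (by linarith), sub_mul,
        div_mul_cancel₀ _ hpos.ne']
      linarith
  obtain ⟨hR, p, hp, hap, hap'⟩ := radial a ha haR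
  obtain ⟨-, q, hq, hbq, hbq'⟩ := radial b hb hbR
  have hsph : ∀ {p q : E}, ‖p‖ = 2 * R → ‖q‖ = 2 * R → 0 ≤ ⟪p, q⟫ →
      intrinsicEDist Uᶜ (c₀ + p) (c₀ + q) ≤ ENNReal.ofReal (4 * R) := by
    intro p q hp hq hpq
    refine (intrinsicEDist_le_edist (segment_subset_compl_of_inner_nonneg hU hR hp hq hpq)).trans ?_
    rw [edist_dist, dist_add_left, dist_eq_norm]
    exact ENNReal.ofReal_le_ofReal ((norm_sub_le p q).trans (by linarith))
  obtain ⟨w, hw, hpw, hwq⟩ : ∃ w : E, ‖w‖ = 2 * R ∧ ⟪p, w⟫ = 0 ∧ 0 ≤ ⟪w, q⟫ := by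
    obtain ⟨w, hw, hpw⟩ := exists_norm_eq_inner_eq_zero hE p (r := 2 * R) (by positivity)
    rcases le_total 0 ⟪w, q⟫ with h | h
    · exact ⟨w, hw, hpw, h⟩
    · exact ⟨-w, by rw [norm_neg, hw], by rw [inner_neg_right, hpw, neg_zero],
        by rw [inner_neg_left]; linarith⟩
  have h1 : intrinsicEDist Uᶜ a (c₀ + p) ≤ ENNReal.ofReal (2 * R) :=
    (intrinsicEDist_le_edist hap).trans (by rw [edist_dist]; exact ENNReal.ofReal_le_ofReal hap')
  have h4 : intrinsicEDist Uᶜ (c₀ + q) b ≤ ENNReal.ofReal (2 * R) :=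
    (intrinsicEDist_le_edist ((segment_symm ℝ _ _).trans_subset hbq)).trans
      (by rw [edist_dist, dist_comm]; exact ENNReal.ofReal_le_ofReal hbq')
  calc _ ≤ _ := intrinsicEDist_triangle _ a (c₀ + p) b
    _ ≤ _ := add_le_add h1 ((intrinsicEDist_triangle _ _ (c₀ + w) b).trans
        (add_le_add (hsph hp hw hpw.ge) ((intrinsicEDist_triangle _ _ (c₀ + q) b).trans
          (add_le_add (hsph hw hq hwq) h4))))
    _ = ENNReal.ofReal (12 * R) := by
      rw [← ENNReal.ofReal_add, ← ENNReal.ofReal_add, ← ENNReal.ofReal_add]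
      · congr 1; ring
      all_goals positivity

theorem intrinsicEDist_frontier_le {C : Set E} (hcomp : IsComplete C) (hconv : Convex ℝ C)
    {a b : E} (ha : a ∈ C) (hb : b ∈ C) :
    intrinsicEDist (frontier C) a b ≤ intrinsicEDist (interior C)ᶜ a b := by
  obtain ⟨π, hL, hC, hid, hU⟩ := exists_metricProjection ⟨a, ha⟩ hcomp hconv
  have := intrinsicEDist_map_le one_ne_zero (hL.lipschitzOnWith (s := (interior C)ᶜ))
    (Y := frontier C) (fun x hx => ⟨subset_closure (hC x), hU _ isOpen_interior interior_subset x hx⟩)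
    a b
  rwa [hid a ha, hid b hb, ENNReal.coe_one, one_mul] at this

end ExteriorDistance

theorem IsClosed.exists_mem_segment_frontier {E : Type*} [NormedAddCommGroup E] [NormedSpace ℝ E]
    {C : Set E} (hC : IsClosed C) {x y : E} (hx : x ∈ C) (hy : y ∉ interior C) :
    ∃ z ∈ segment ℝ x y, z ∈ frontier C := by
  rw [hC.frontier_eq]
  by_contra! h
  have hx' : x ∈ interior C := by
    by_contra hx'
    exact h x (left_mem_segment ℝ x y) ⟨hx, hx'⟩
  have hy' : y ∉ C := fun hy' => h y (right_mem_segment ℝ x y) ⟨hy', hy⟩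
  obtain ⟨z, -, hz1, hz2⟩ := (convex_segment (𝕜 := ℝ) x y).isPreconnected (interior C) Cᶜ
    isOpen_interior hC.isOpen_compl
    (fun z hz => by
      by_cases hzC : z ∈ C
      · exact Or.inl (by_contra fun hzi => h z hz ⟨hzC, hzi⟩)
      · exact Or.inr hzC)
    ⟨x, left_mem_segment ℝ x y, hx'⟩ ⟨y, right_mem_segment ℝ x y, hy'⟩
  exact hz2 (interior_subset hz1)

section ConvexBody

variable {E : Type*} [NormedAddCommGroup E] [InnerProductSpace ℝ E] [FiniteDimensional ℝ E]

theorem IsConvexBody.exists_intrinsicEDist_le (hE : 2 ≤ Module.finrank ℝ E) {C : Set E}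
    (hC : IsConvexBody C) :
    ∃ B, ∀ a ∈ frontier C, ∀ b ∈ frontier C, intrinsicEDist (frontier C) a b ≤ ENNReal.ofReal B := by
  obtain ⟨hcomp, hconv, c₀, hc₀⟩ := hC
  obtain ⟨R, hR⟩ := hcomp.isBounded.subset_closedBall c₀
  have hf : frontier C ⊆ C := hcomp.isClosed.frontier_subset
  refine ⟨12 * R, fun a ha b hb => ?_⟩
  refine (intrinsicEDist_frontier_le hcomp.isClosed.isComplete hconv (hf ha) (hf hb)).trans ?_
  exact intrinsicEDist_compl_le hE hconv.interior hc₀ (interior_subset.trans hR) ha.2 hb.2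
    (mem_closedBall_iff_norm.1 (hR (hf ha))) (mem_closedBall_iff_norm.1 (hR (hf hb)))

theorem IsConvexBody.intrinsicEDist_ne_top (hE : 2 ≤ Module.finrank ℝ E) {C : Set E}
    (hC : IsConvexBody C) : ∀ a ∈ frontier C, ∀ b ∈ frontier C,
      intrinsicEDist (frontier C) a b ≠ ⊤ := by
  obtain ⟨B, hB⟩ := hC.exists_intrinsicEDist_le hE
  exact fun a ha b hb => ne_top_of_le_ne_top ENNReal.ofReal_ne_top (hB a ha b hb)

theorem IsConvexBody.intrinsicDist_le_intrinsicDiam (hE : 2 ≤ Module.finrank ℝ E) {C : Set E}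
    (hC : IsConvexBody C) {a b : E} (ha : a ∈ frontier C) (hb : b ∈ frontier C) :
    intrinsicDist (frontier C) a b ≤ intrinsicDiam (frontier C) := by
  obtain ⟨B, hB⟩ := hC.exists_intrinsicEDist_le hE
  refine le_csSup ⟨max B 0, ?_⟩ ⟨a, ha, b, hb, rfl⟩
  rintro _ ⟨x, hx, y, hy, rfl⟩
  exact ENNReal.toReal_le_of_le_ofReal (le_max_right _ _)
    ((hB x hx y hy).trans (ENNReal.ofReal_le_ofReal (le_max_left _ _)))

theorem IsConvexBody.intrinsicDiam_pos (hE : 2 ≤ Module.finrank ℝ E) {C : Set E}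
    (hC : IsConvexBody C) : 0 < intrinsicDiam (frontier C) := by
  obtain ⟨hcomp, -, c₀, hc₀⟩ := id hC
  obtain ⟨R, hR0, hR⟩ := hcomp.isBounded.subset_closedBall_lt 0 c₀
  have key : ∀ v : E, ‖v‖ = 1 → ∃ s > (0 : ℝ), c₀ + s • v ∈ frontier C := by
    intro v hv
    have hout : c₀ + (R + 1) • v ∉ C := fun h => by
      have := hR h
      rw [mem_closedBall_iff_norm, add_sub_cancel_left, norm_smul, hv, mul_one,
        Real.norm_of_nonneg (by linarith)] at this
      linarith
    obtain ⟨x, hx, hxf⟩ := hcomp.isClosed.exists_mem_segment_frontier (interior_subset hc₀)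
      (fun h => hout (interior_subset h))
    rw [segment_eq_image'] at hx
    obtain ⟨t, ht, rfl⟩ := hx
    simp only [add_sub_cancel_left, smul_smul] at hxf
    refine ⟨t * (R + 1), mul_pos (lt_of_le_of_ne ht.1 ?_) (by linarith), hxf⟩
    rintro rfl
    simp only [zero_mul, zero_smul, add_zero] at hxf
    exact hxf.2 hc₀
  obtain ⟨v, hv, -⟩ := exists_norm_eq_inner_eq_zero hE (0 : E) (r := 1) zero_le_one
  obtain ⟨s, hs, hsf⟩ := key v hv
  obtain ⟨t, ht, htf⟩ := key (-v) (by rwa [norm_neg])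
  have h1 := hC.intrinsicDist_le_intrinsicDiam hE hsf htf
  refine lt_of_lt_of_le ?_ h1
  refine ENNReal.toReal_pos ?_ (hC.intrinsicEDist_ne_top hE _ hsf _ htf)
  refine (lt_of_lt_of_le (edist_pos.2 ?_) (edist_le_intrinsicEDist _ _ _)).ne'
  intro h
  have h2 : (s + t) • v = 0 := by
    rw [add_smul, add_left_cancel h, smul_neg, neg_add_cancel]
  rcases smul_eq_zero.1 h2 with h | h
  · linarith
  · rw [h, norm_zero] at hv
    exact zero_ne_one hv

end ConvexBody

section PolyhedralApproximation

open scoped RealInnerProductSpace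

variable {E : Type*} [NormedAddCommGroup E] [InnerProductSpace ℝ E]

theorem intrinsicEDist_anti {X Y : Set E} (h : X ⊆ Y) (a b : E) :
    intrinsicEDist Y a b ≤ intrinsicEDist X a b :=
  le_intrinsicEDist fun _ hc h0 h1 hm => intrinsicEDist_le hc h0 h1 (hm.mono_right h)

theorem intrinsicEDist_compl_le_of_homothety {C U : Set E} (hUo : IsOpen U) (hUc : Convex ℝ U)
    {c₀ : E} (hc₀ : c₀ ∈ U) {ε : ℝ} (hε : 0 < ε)
    (hUC : ∀ z ∈ U, c₀ + (1 + ε)⁻¹ • (z - c₀) ∈ C) {a b a' b' : E} (ha : a ∉ U) (hb : b ∉ U)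
    {s t : ℝ} (hs : s ∈ Icc 1 (1 + ε)) (ht : t ∈ Icc 1 (1 + ε))
    (has : c₀ + (1 + ε) • (a' - c₀) = c₀ + s • (a - c₀))
    (hbt : c₀ + (1 + ε) • (b' - c₀) = c₀ + t • (b - c₀)) :
    intrinsicEDist Uᶜ a b ≤ ENNReal.ofReal (1 + ε) * intrinsicEDist (frontier C) a' b' +
      (ENNReal.ofReal (ε * ‖a - c₀‖) + ENNReal.ofReal (ε * ‖b - c₀‖)) := by
  have h1ε : 0 < 1 + ε := by linarith
  have hrad : ∀ {a s}, a ∉ U → s ∈ Icc 1 (1 + ε) → segment ℝ a (c₀ + s • (a - c₀)) ⊆ Uᶜ ∧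
      edist a (c₀ + s • (a - c₀)) ≤ ENNReal.ofReal (ε * ‖a - c₀‖) := by
    intro a s ha hs
    refine ⟨segment_subset_compl_of_convex hUc hc₀ ha hs.1, ?_⟩
    have e : c₀ + s • (a - c₀) - a = (s - 1) • (a - c₀) := by module
    rw [edist_dist, dist_comm, dist_eq_norm, e, norm_smul,
      Real.norm_of_nonneg (sub_nonneg.2 hs.1)]
    exact ENNReal.ofReal_le_ofReal
      (mul_le_mul_of_nonneg_right (by linarith [hs.2]) (norm_nonneg _))
  set g : E → E := fun z => c₀ + (1 + ε) • (z - c₀) with hg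
  have hgL : LipschitzWith (Real.toNNReal (1 + ε)) g := by
    refine LipschitzWith.of_dist_le_mul fun x y => ?_
    have e : g x - g y = (1 + ε) • (x - y) := by simp only [hg]; module
    rw [dist_eq_norm, e, norm_smul, Real.coe_toNNReal _ h1ε.le, dist_eq_norm,
      Real.norm_of_nonneg h1ε.le]
  have hgm : MapsTo g (frontier C) Uᶜ := by
    intro y hy hyU
    apply hy.2
    refine mem_interior.2 ⟨g ⁻¹' U, fun z hz => ?_, hUo.preimage hgL.continuous, hyU⟩
    have := hUC _ hz
    simp only [hg] at this
    rwa [add_sub_cancel_left, smul_smul, inv_mul_cancel₀ h1ε.ne', one_smul,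
      add_sub_cancel] at this
  have hmid := intrinsicEDist_map_le (by simpa using h1ε) (hgL.lipschitzOnWith (s := frontier C))
    hgm a' b'
  simp only [hg, has, hbt] at hmid
  obtain ⟨p1, p2⟩ := hrad ha hs
  obtain ⟨q1, q2⟩ := hrad hb ht
  rw [segment_symm] at q1
  rw [edist_comm] at q2
  calc intrinsicEDist Uᶜ a b
      ≤ ENNReal.ofReal (ε * ‖a - c₀‖) + (ENNReal.ofReal (1 + ε) * intrinsicEDist (frontier C) a' b'
        + ENNReal.ofReal (ε * ‖b - c₀‖)) :=
        (intrinsicEDist_triangle _ _ (c₀ + s • (a - c₀)) _).trans <| add_le_add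
          ((intrinsicEDist_le_edist p1).trans p2) <|
          (intrinsicEDist_triangle _ _ (c₀ + t • (b - c₀)) _).trans <| add_le_add hmid
            ((intrinsicEDist_le_edist q1).trans q2)
    _ = _ := by ring

/-- Supporting functionals of a convex body. -/
theorem IsConvexBody.exists_support [CompleteSpace E] {C : Set E} (hC : IsConvexBody C) :
    ∃ ν : E → E, ∀ y ∈ frontier C, (∀ z ∈ interior C, ⟪ν y, z⟫ < ⟪ν y, y⟫) ∧
      ∀ z ∈ C, ⟪ν y, z⟫ ≤ ⟪ν y, y⟫ := by
  obtain ⟨hcomp, hconv, hint⟩ := hC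
  have key : ∀ y, ∃ ν : E, y ∈ frontier C → (∀ z ∈ interior C, ⟪ν, z⟫ < ⟪ν, y⟫) ∧
      ∀ z ∈ C, ⟪ν, z⟫ ≤ ⟪ν, y⟫ := by
    intro y
    by_cases hy : y ∈ frontier C
    · obtain ⟨f, hf⟩ := geometric_hahn_banach_open_point hconv.interior isOpen_interior hy.2
      have hf' : ∀ x, ⟪(InnerProductSpace.toDual ℝ E).symm f, x⟫ = f x :=
        fun x => InnerProductSpace.toDual_symm_apply
      refine ⟨(InnerProductSpace.toDual ℝ E).symm f, fun _ => ?_⟩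
      simp only [hf']
      refine ⟨hf, fun z hz => ?_⟩
      have hz' : z ∈ closure (interior C) := by
        rw [hconv.closure_interior_eq_closure_of_nonempty_interior hint]
        exact subset_closure hz
      exact closure_minimal (fun x hx => (hf x hx).le)
        (isClosed_le f.continuous continuous_const) hz'
    · exact ⟨0, fun h => absurd h hy⟩
  exact ⟨fun y => (key y).choose, fun y hy => (key y).choose_spec hy⟩

variable [FiniteDimensional ℝ E]

/-- Outer approximation of a convex body by a polyhedron touching it at prescribed points. -/
theorem IsConvexBody.exists_polyhedron {C : Set E} (hC : IsConvexBody C) {c₀ : E}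
    (hc₀ : c₀ ∈ interior C) {ε : ℝ} (hε : 0 < ε) {T : Finset E} (hT : ↑T ⊆ frontier C) :
    ∃ (S : Finset E) (ν : E → E), T ⊆ S ∧ ↑S ⊆ frontier C ∧
      (∀ y ∈ S, (∀ z ∈ interior C, ⟪ν y, z⟫ < ⟪ν y, y⟫) ∧ ∀ z ∈ C, ⟪ν y, z⟫ ≤ ⟪ν y, y⟫) ∧
      ∀ z, (∀ y ∈ S, ⟪ν y, z⟫ ≤ ⟪ν y, y⟫) → c₀ + (1 + ε)⁻¹ • (z - c₀) ∈ C := by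
  classical
  have := FiniteDimensional.complete ℝ E
  obtain ⟨ν, hν⟩ := hC.exists_support
  have h1ε : 0 < 1 + ε := by linarith
  have hfc : IsCompact (frontier C) := hC.1.of_isClosed_subset isClosed_frontier
    hC.1.isClosed.frontier_subset
  obtain ⟨S, hS, hcov⟩ := hfc.elim_nhds_subcover
    (fun y => {x | ⟪ν y, y⟫ < ⟪ν y, c₀ + (1 + ε) • (x - c₀)⟫}) (fun y hy => by
      refine (isOpen_lt continuous_const (by fun_prop)).mem_nhds ?_
      have h1 := (hν y hy).1 c₀ hc₀
      have h2 := mul_pos hε (sub_pos.2 h1)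
      rw [mem_ofPred_eq, inner_add_right, inner_smul_right, inner_sub_right]
      linarith)
  have hST : (↑(T ∪ S) : Set E) ⊆ frontier C := by
    rw [Finset.coe_union]
    exact union_subset hT hS
  refine ⟨T ∪ S, ν, Finset.subset_union_left, hST, fun y hy => hν y (hST hy), fun z hz => ?_⟩
  by_contra hzC
  obtain ⟨w, hw, hwf⟩ := hC.1.isClosed.exists_mem_segment_frontier (interior_subset hc₀)
    (fun h => hzC (interior_subset h))
  rw [segment_eq_image'] at hw
  obtain ⟨t, ht, rfl⟩ := hw
  obtain ⟨y, hy, hyw⟩ := mem_iUnion₂.1 (hcov hwf)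
  have e : c₀ + (1 + ε) • (c₀ + t • (c₀ + (1 + ε)⁻¹ • (z - c₀) - c₀) - c₀) =
      c₀ + t • (z - c₀) := by
    rw [add_sub_cancel_left, add_sub_cancel_left, smul_smul, smul_smul]
    congr 2
    field_simp
  simp only [mem_ofPred_eq, e] at hyw
  have h1 := hz y (Finset.mem_union_right _ hy)
  have h2 := (hν y (hS y hy)).1 c₀ hc₀
  rw [inner_add_right, inner_smul_right, inner_sub_right] at hyw
  nlinarith [ht.1, ht.2, mul_nonneg ht.1 (sub_nonneg.2 h1), mul_nonneg (sub_nonneg.2 ht.2)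
    (sub_nonneg.2 h2.le)]

/-- A polyhedron `{z | ∀ i, ⟪ν i, z⟫ ≤ c i}` around a convex body `C`, close to it up to the factor
`1 + ε` around the center `c₀`, whose exterior distance is close to the intrinsic distance of the
boundary of `C`. -/
structure IsOuterPolyhedron {ι : Type*} (C : Set E) (c₀ : E) (R ε : ℝ) (ν : ι → E) (c : ι → ℝ) :
    Prop where
  le : ∀ z ∈ C, ∀ i, ⟪ν i, z⟫ ≤ c i
  lt : ∀ z ∈ interior C, ∀ i, ⟪ν i, z⟫ < c i
  mem : ∀ z, (∀ i, ⟪ν i, z⟫ ≤ c i) → c₀ + (1 + ε)⁻¹ • (z - c₀) ∈ C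
  ne_top : ∀ x ∈ {z | ∃ i, c i ≤ ⟪ν i, z⟫}, ∀ y ∈ {z | ∃ i, c i ≤ ⟪ν i, z⟫},
    intrinsicEDist {z | ∃ i, c i ≤ ⟪ν i, z⟫} x y ≠ ⊤
  intrinsicDist_le : ∀ a ∈ C, ∀ b ∈ C, a ∈ {z | ∃ i, c i ≤ ⟪ν i, z⟫} →
    b ∈ {z | ∃ i, c i ≤ ⟪ν i, z⟫} →
    intrinsicDist (frontier C) a b ≤ intrinsicDist {z | ∃ i, c i ≤ ⟪ν i, z⟫} a b
  le_intrinsicDist : ∀ a ∈ C, ∀ b ∈ C, a ∈ {z | ∃ i, c i ≤ ⟪ν i, z⟫} →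
    b ∈ {z | ∃ i, c i ≤ ⟪ν i, z⟫} →
    intrinsicDist {z | ∃ i, c i ≤ ⟪ν i, z⟫} a b ≤
      (1 + ε) * intrinsicDist (frontier C) a b + 4 * ε * R
  le_intrinsicDiam : ∀ a b, (∀ i, ⟪ν i, a⟫ ≤ c i) → (∀ i, ⟪ν i, b⟫ ≤ c i) →
    a ∈ {z | ∃ i, c i ≤ ⟪ν i, z⟫} → b ∈ {z | ∃ i, c i ≤ ⟪ν i, z⟫} →
    intrinsicDist {z | ∃ i, c i ≤ ⟪ν i, z⟫} a b ≤
      (1 + ε) * intrinsicDiam (frontier C) + 4 * ε * R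

theorem IsConvexBody.exists_isOuterPolyhedron (hE : 2 ≤ Module.finrank ℝ E) {C : Set E}
    (hC : IsConvexBody C) {c₀ : E} (hc₀ : c₀ ∈ interior C) {R : ℝ}
    (hR : C ⊆ Metric.closedBall c₀ R) {ε : ℝ} (hε : 0 < ε) (hε1 : ε ≤ 1) {T : Finset E}
    (hT : ↑T ⊆ frontier C) :
    ∃ (S : Finset E) (ν : S → E) (c : S → ℝ), IsOuterPolyhedron C c₀ R ε ν c ∧
      ∀ z ∈ T, ∃ i, ⟪ν i, z⟫ = c i := by
  obtain ⟨S, ν, hTS, hSf, hS, hP⟩ := hC.exists_polyhedron hc₀ hε hT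
  have hR0 : 0 ≤ R := by
    simpa using hR (interior_subset hc₀)
  have h1ε : 0 < 1 + ε := by linarith
  set Ω : Set E := {z | ∃ i : S, ⟪ν i, (i : E)⟫ ≤ ⟪ν i, z⟫} with hΩ
  set U : Set E := {z | ∀ i : S, ⟪ν i, z⟫ < ⟪ν i, (i : E)⟫} with hU
  have hΩU : Ω = Uᶜ := by
    ext z
    simp only [hΩ, hU, mem_ofPred_eq, mem_compl_iff, not_forall, not_lt]
  have hUe : U = ⋂ i : S, {z | ⟪ν i, z⟫ < ⟪ν i, (i : E)⟫} := by ext; simp [hU]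
  have hUo : IsOpen U := by
    rw [hUe]
    exact isOpen_iInter_of_finite fun i => isOpen_lt (by fun_prop) (by fun_prop)
  have hUc : Convex ℝ U := by
    rw [hUe]
    exact convex_iInter fun i => convex_halfSpace_lt (f := fun x => ⟪ν i, x⟫)
      (innerₛₗ ℝ (ν i)).isLinear _
  have hCU : interior C ⊆ U := fun z hz i => (hS i i.2).1 z hz
  have hUC : ∀ z ∈ U, c₀ + (1 + ε)⁻¹ • (z - c₀) ∈ C := fun z hz =>
    hP z fun y hy => (hz ⟨y, hy⟩).le
  have hPR : ∀ z, c₀ + (1 + ε)⁻¹ • (z - c₀) ∈ C → ‖z - c₀‖ ≤ 2 * R := by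
    intro z hz
    have h1 := hR hz
    rw [mem_closedBall_iff_norm, add_sub_cancel_left, norm_smul, norm_inv,
      Real.norm_of_nonneg h1ε.le, inv_mul_le_iff₀ h1ε] at h1
    nlinarith
  have hUR : U ⊆ Metric.closedBall c₀ (2 * R) := fun z hz =>
    mem_closedBall_iff_norm.2 (hPR z (hUC z hz))
  have hXfin := hC.intrinsicEDist_ne_top hE
  have hfin : ∀ x ∈ Ω, ∀ y ∈ Ω, intrinsicEDist Ω x y ≠ ⊤ := by
    rw [hΩU]
    intro x hx y hy
    refine ne_top_of_le_ne_top ENNReal.ofReal_ne_top (intrinsicEDist_compl_le hE hUc (hCU hc₀)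
      (R := max (2 * R) (max ‖x - c₀‖ ‖y - c₀‖))
      (hUR.trans (Metric.closedBall_subset_closedBall (le_max_left _ _))) hx hy ?_ ?_)
    · exact (le_max_left _ _).trans (le_max_right _ _)
    · exact (le_max_right _ _).trans (le_max_right _ _)
  have hCf : ∀ a ∈ C, a ∈ Ω → a ∈ frontier C := fun a ha haΩ => by
    rw [hΩU] at haΩ
    exact ⟨subset_closure ha, fun h => haΩ (hCU h)⟩
  have hscale : ∀ {a b a' b' s t}, a ∈ Ω → b ∈ Ω → ‖a - c₀‖ ≤ 2 * R → ‖b - c₀‖ ≤ 2 * R →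
      a' ∈ frontier C → b' ∈ frontier C → s ∈ Icc 1 (1 + ε) → t ∈ Icc 1 (1 + ε) →
      c₀ + (1 + ε) • (a' - c₀) = c₀ + s • (a - c₀) →
      c₀ + (1 + ε) • (b' - c₀) = c₀ + t • (b - c₀) →
      intrinsicDist Ω a b ≤ (1 + ε) * intrinsicDist (frontier C) a' b' + 4 * ε * R := by
    intro a b a' b' s t ha hb haR hbR ha' hb' hs ht has hbt
    rw [hΩU] at ha hb
    have h := intrinsicEDist_compl_le_of_homothety hUo hUc (hCU hc₀) hε hUC ha hb hs ht has hbt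
    rw [← hΩU] at h
    have h2 := ENNReal.toReal_mono (ENNReal.add_ne_top.2
      ⟨ENNReal.mul_ne_top ENNReal.ofReal_ne_top (hXfin _ ha' _ hb'),
        ENNReal.add_ne_top.2 ⟨ENNReal.ofReal_ne_top, ENNReal.ofReal_ne_top⟩⟩) h
    rw [ENNReal.toReal_add (ENNReal.mul_ne_top ENNReal.ofReal_ne_top (hXfin _ ha' _ hb'))
        (ENNReal.add_ne_top.2 ⟨ENNReal.ofReal_ne_top, ENNReal.ofReal_ne_top⟩),
      ENNReal.toReal_add ENNReal.ofReal_ne_top ENNReal.ofReal_ne_top, ENNReal.toReal_mul,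
      ENNReal.toReal_ofReal h1ε.le, ENNReal.toReal_ofReal (by positivity),
      ENNReal.toReal_ofReal (by positivity)] at h2
    have h3 := mul_le_mul_of_nonneg_left haR hε.le
    have h4 := mul_le_mul_of_nonneg_left hbR hε.le
    refine h2.trans ?_
    change (1 + ε) * intrinsicDist (frontier C) a' b' + _ ≤ _
    linarith
  have hproj : ∀ a, (∀ i : S, ⟪ν i, a⟫ ≤ ⟪ν i, (i : E)⟫) → a ∈ Ω → ∃ a' ∈ frontier C,
      ∃ s ∈ Icc 1 (1 + ε), c₀ + (1 + ε) • (a' - c₀) = c₀ + s • (a - c₀) := by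
    intro a ha haΩ
    rw [hΩU] at haΩ
    obtain ⟨a', ha', haf⟩ := hC.1.isClosed.exists_mem_segment_frontier
      (hP a fun y hy => ha ⟨y, hy⟩) (fun h => haΩ (hCU h))
    rw [segment_eq_image'] at ha'
    obtain ⟨t, ht, rfl⟩ := ha'
    refine ⟨_, haf, 1 + t * ε, ⟨by nlinarith [ht.1], by nlinarith [ht.2]⟩, ?_⟩
    have e : c₀ + (1 + ε)⁻¹ • (a - c₀) + t • (a - (c₀ + (1 + ε)⁻¹ • (a - c₀))) - c₀ =
        ((1 + ε)⁻¹ + t * (1 - (1 + ε)⁻¹)) • (a - c₀) := by module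
    rw [e, smul_smul]
    congr 2
    field_simp
    ring
  have hbdC : ∀ a ∈ C, ‖a - c₀‖ ≤ 2 * R := fun a ha => by
    have := mem_closedBall_iff_norm.1 (hR ha)
    linarith
  have h1I : 1 + ε ∈ Icc 1 (1 + ε) := ⟨by linarith, le_rfl⟩
  refine ⟨S, fun i => ν i, fun i => ⟪ν i, (i : E)⟫, ⟨fun z hz i => (hS i i.2).2 z hz, hCU,
    fun z hz => hP z fun y hy => hz ⟨y, hy⟩, hfin, fun a ha b hb haΩ hbΩ => ?_,
    fun a ha b hb haΩ hbΩ => ?_, fun a b ha hb haΩ hbΩ => ?_⟩, fun z hz => ⟨⟨z, hTS hz⟩, rfl⟩⟩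
  · refine ENNReal.toReal_mono (hfin _ haΩ _ hbΩ)
      ((intrinsicEDist_frontier_le hC.1.isClosed.isComplete hC.2.1 ha hb).trans
        (intrinsicEDist_anti ?_ _ _))
    change Ω ⊆ _
    rw [hΩU]
    exact compl_subset_compl.2 hCU
  · exact hscale haΩ hbΩ (hbdC a ha) (hbdC b hb) (hCf a ha haΩ) (hCf b hb hbΩ) h1I h1I rfl rfl
  · obtain ⟨a', ha', s, hs, has⟩ := hproj a ha haΩ
    obtain ⟨b', hb', t, ht, hbt⟩ := hproj b hb hbΩ
    refine (hscale haΩ hbΩ (hPR a (hP a fun y hy => ha ⟨y, hy⟩))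
      (hPR b (hP b fun y hy => hb ⟨y, hy⟩)) ha' hb' hs ht has hbt).trans ?_
    have := mul_le_mul_of_nonneg_left (hC.intrinsicDist_le_intrinsicDiam hE ha' hb') h1ε.le
    linarith

end PolyhedralApproximation

section UpwardChart

open Filter Topology
open scoped RealInnerProductSpace

variable {E : Type*} [NormedAddCommGroup E] [InnerProductSpace ℝ E]

/-- Around the segment `x + t h`, `t ∈ [0,1]`, the graph of the `L`-Lipschitz function `f` in the
direction `e` is the lower boundary of `C`. -/
structure IsUpwardChart (C : Set E) (e x h : E) (L r : ℝ) (f : E → ℝ) : Prop where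
  norm_eq : ‖e‖ = 1
  inner_eq : ⟪e, h⟫ = 0
  pos : 0 < r
  nonneg : 0 ≤ L
  mem : ∀ t ∈ Icc (0 : ℝ) 1, ∀ w, ⟪e, w⟫ = 0 → ‖w‖ ≤ r →
    x + t • h + w + f (x + t • h + w) • e ∈ C
  le : ∀ t ∈ Icc (0 : ℝ) 1, ∀ w, ⟪e, w⟫ = 0 → ‖w‖ ≤ r → ∀ η : ℝ,
    x + t • h + w + η • e ∈ C → f (x + t • h + w) ≤ η
  abs_sub_le : ∀ t ∈ Icc (0 : ℝ) 1, ∀ w, ⟪e, w⟫ = 0 → ‖w‖ ≤ r →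
    |f (x + t • h + w) - f (x + t • h)| ≤ L * ‖w‖
  exists_above : ∀ t ∈ Icc (0 : ℝ) 1, ∃ τ > f (x + t • h), x + t • h + τ • e ∈ interior C

namespace IsUpwardChart

variable {C : Set E} {e x h : E} {L r : ℝ} {f : E → ℝ}

theorem mem_self (hf : IsUpwardChart C e x h L r f) {t : ℝ} (ht : t ∈ Icc (0 : ℝ) 1) :
    x + t • h + f (x + t • h) • e ∈ C := by
  simpa using hf.mem t ht 0 (by simp) (by simpa using hf.pos.le)

theorem mem_frontier (hf : IsUpwardChart C e x h L r f) {t : ℝ} (ht : t ∈ Icc (0 : ℝ) 1) :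
    x + t • h + f (x + t • h) • e ∈ frontier C := by
  refine ⟨subset_closure (hf.mem_self ht), fun hint => ?_⟩
  have hcont : Continuous fun η : ℝ => x + t • h + η • e := by fun_prop
  have hev : ∀ᶠ η in 𝓝 (f (x + t • h)), x + t • h + η • e ∈ interior C :=
    hcont.continuousAt.eventually (isOpen_interior.mem_nhds hint)
  obtain ⟨η, hη, hlt⟩ := ((hev.filter_mono nhdsWithin_le_nhds).and
    (self_mem_nhdsWithin : Iio (f (x + t • h)) ∈ 𝓝[<] (f (x + t • h)))).exists
  have := hf.le t ht 0 (by simp) (by simpa using hf.pos.le) η (by simpa using interior_subset hη)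
  rw [add_zero] at this
  exact absurd hlt (not_lt.2 this)

theorem exists_isLowerGraph {ι : Type*} [Finite ι] (hf : IsUpwardChart C e x h L r f) {c₀ : E}
    {R ε : ℝ} {ν : ι → E} {c : ι → ℝ} (hR : C ⊆ Metric.closedBall c₀ R) (hε : 0 < ε)
    (hP : IsOuterPolyhedron C c₀ R ε ν c) (hεr : 2 * ((L + 1) * (ε * R)) ≤ r)
    (h0 : ∃ i, ⟪ν i, x + (0 : ℝ) • h + f (x + (0 : ℝ) • h) • e⟫ = c i) :
    ∃ φ : ℝ → ℝ, IsLowerGraph ν c e x h L φ ∧ ∀ t ∈ Icc (0 : ℝ) 1,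
      (∃ i, ⟪ν i, x + t • h + f (x + t • h) • e⟫ = c i) → φ t = f (x + t • h) := by
  classical
  cases nonempty_fintype ι
  have hsub : ∀ t y z : ℝ, x + t • h + y • e = x + t • h + z • e + (y - z) • e :=
    fun t y z => by module
  have hneg : ∀ t ∈ Icc (0 : ℝ) 1, ∀ i, ∀ η ≤ f (x + t • h), ⟪ν i, x + t • h + η • e⟫ = c i →
      ⟪ν i, e⟫ < 0 := by
    intro t ht i η hη hi
    obtain ⟨τ, hτ, hτC⟩ := hf.exists_above t ht
    have := hP.lt _ hτC i
    rw [hsub t τ η, inner_add_right, hi, inner_smul_right] at this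
    have h1 : 0 < τ - η := by linarith
    by_contra! h2
    have := mul_nonneg h1.le h2
    linarith
  obtain ⟨i₀, hi₀⟩ := h0
  have hi₀' := hneg 0 (by simp) i₀ _ le_rfl hi₀
  set S : Finset ι := Finset.univ.filter fun i => ⟪ν i, e⟫ < 0 with hS
  have hSne : S.Nonempty := ⟨i₀, by simpa [hS] using hi₀'⟩
  set g : ι → ℝ → ℝ := fun i t => (⟪ν i, x + t • h⟫ - c i) / (-⟪ν i, e⟫) with hg
  set φ : ℝ → ℝ := fun t => S.sup' hSne fun i => g i t with hφ
  have hgeq : ∀ i t, ⟪ν i, e⟫ < 0 → ⟪ν i, x + t • h + g i t • e⟫ = c i := by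
    intro i t hi
    rw [inner_add_right, inner_smul_right]
    simp only [hg]
    field_simp [hi.ne]
    ring
  have hle_iff : ∀ i t η, ⟪ν i, e⟫ < 0 → (⟪ν i, x + t • h + η • e⟫ ≤ c i ↔ g i t ≤ η) := by
    intro i t η hi
    rw [hsub t η (g i t), inner_add_right, hgeq i t hi, inner_smul_right]
    constructor
    · intro h1
      by_contra! h2
      have := mul_pos_of_neg_of_neg (sub_neg.2 h2) hi
      linarith
    · intro h1
      have := mul_nonneg (sub_nonneg.2 h1) (neg_nonneg.2 hi.le)
      linarith
  have hφle : ∀ t ∈ Icc (0 : ℝ) 1, φ t ≤ f (x + t • h) := by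
    intro t ht
    refine Finset.sup'_le _ _ fun i hi => ?_
    have hi' : ⟪ν i, e⟫ < 0 := by simpa [hS] using hi
    exact (hle_iff i t _ hi').1 (hP.le _ (hf.mem_self ht) i)
  have hleφ : ∀ t i, ⟪ν i, e⟫ < 0 → ⟪ν i, x + t • h + φ t • e⟫ ≤ c i := fun t i hi =>
    (hle_iff i t _ hi).2 (Finset.le_sup' (fun i => g i t) (by simpa [hS] using hi))
  have hmemP : ∀ t ∈ Icc (0 : ℝ) 1, ∀ i, ⟪ν i, x + t • h + φ t • e⟫ ≤ c i := by
    intro t ht i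
    rcases lt_or_ge ⟪ν i, e⟫ 0 with hi | hi
    · exact hleφ t i hi
    · have h1 := hP.le _ (hf.mem_self ht) i
      rw [hsub t _ (φ t), inner_add_right, inner_smul_right] at h1
      have := mul_nonneg (sub_nonneg.2 (hφle t ht)) hi
      linarith
  have hnegφ : ∀ t ∈ Icc (0 : ℝ) 1, ∀ i, ⟪ν i, x + t • h + φ t • e⟫ = c i → ⟪ν i, e⟫ < 0 :=
    fun t ht i hi => hneg t ht i _ (hφle t ht) hi
  have h1ε : 0 < 1 + ε := by linarith
  have hL := hf.nonneg
  have hclose : ∀ t ∈ Icc (0 : ℝ) 1, f (x + t • h) - φ t ≤ (L + 1) * (ε * R) := by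
    intro t ht
    have hy := hP.mem _ (hmemP t ht)
    set y := c₀ + (1 + ε)⁻¹ • (x + t • h + φ t • e - c₀) with hyd
    set d := ε • (c₀ - y) with hd
    have hyd' : y = x + t • h + φ t • e + d := by
      have e1 : (1 + ε) • (y - c₀) = x + t • h + φ t • e - c₀ := by
        rw [hyd, add_sub_cancel_left, smul_smul, mul_inv_cancel₀ h1ε.ne', one_smul]
      have e2 : x + t • h + φ t • e = c₀ + (1 + ε) • (y - c₀) := by rw [e1]; abel
      rw [e2, hd]
      module
    have hdR : ‖d‖ ≤ ε * R := by
      rw [hd, norm_smul, Real.norm_of_nonneg hε.le, ← dist_eq_norm, dist_comm]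
      exact mul_le_mul_of_nonneg_left (hR hy) hε.le
    have hη : |⟪e, d⟫| ≤ ‖d‖ := by
      have := abs_real_inner_le_norm e d
      rwa [hf.norm_eq, one_mul] at this
    set η := ⟪e, d⟫ with hηd
    set w := d - η • e with hw
    have hew : ⟪e, w⟫ = 0 := by
      rw [hw, inner_sub_right, ← hηd, real_inner_smul_right e e, real_inner_self_eq_norm_sq,
        hf.norm_eq]
      ring
    have hwd : ‖w‖ ≤ ‖d‖ := by
      have h1 : ‖d‖ ^ 2 = ‖w‖ ^ 2 + η ^ 2 := by
        have : d = w + η • e := by rw [hw]; abel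
        rw [this, norm_add_sq_real, inner_smul_right, real_inner_comm, hew, norm_smul, hf.norm_eq,
          mul_one, Real.norm_eq_abs, sq_abs]
        ring
      refine le_of_sq_le_sq ?_ (norm_nonneg _)
      nlinarith [sq_nonneg η]
    have hdε : 0 ≤ ε * R := (norm_nonneg d).trans hdR
    have hwr : ‖w‖ ≤ r := by nlinarith
    have h1 := hf.le t ht w hew hwr (φ t + η) (by
      convert hy using 1
      rw [hyd', hw]
      module)
    have h2 := hf.abs_sub_le t ht w hew hwr
    have h3 := (abs_le.1 h2).1
    have h4 := (abs_le.1 hη).2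
    have h5 := mul_le_mul_of_nonneg_left (hwd.trans hdR) hL
    linarith
  refine ⟨φ, ⟨hf.norm_eq, ?_, fun t => ?_, hleφ, hmemP, hnegφ, ?_⟩, ?_⟩
  · refine Continuous.finset_sup'_apply hSne fun i _ => ?_
    simp only [hg]
    fun_prop
  · obtain ⟨i, hi, hi'⟩ := S.exists_mem_eq_sup' hSne fun i => g i t
    have hin : ⟪ν i, e⟫ < 0 := by simpa [hS] using hi
    refine ⟨i, ?_, hin⟩
    simp only [hφ]
    rw [hi']
    exact hgeq i t hin
  · intro t ht i hi σ hσ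
    have hin := hnegφ t ht i hi
    rw [inner_add_right, inner_smul_right] at hσ
    have hpyth : ‖h + σ • e‖ ^ 2 = ‖h‖ ^ 2 + σ ^ 2 := by
      rw [norm_add_sq_real, inner_smul_right, real_inner_comm, hf.inner_eq, norm_smul, hf.norm_eq,
        mul_one, Real.norm_eq_abs, sq_abs]
      ring
    have hbd : ∀ u : ℝ, |u| * ‖h‖ ≤ r → u * σ ≤ L * r + (L + 1) * (ε * R) := by
      intro u hu
      have hwr : ‖u • h‖ ≤ r := by rwa [norm_smul]
      have hew : ⟪e, u • h⟫ = 0 := by rw [inner_smul_right, hf.inner_eq, mul_zero]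
      have h1 := hP.le _ (hf.mem t ht _ hew hwr) i
      have h2 := (abs_le.1 (hf.abs_sub_le t ht _ hew hwr)).2
      have h3 := hclose t ht
      have h4 := mul_le_mul_of_nonneg_left hwr hL
      set F := f (x + t • h + u • h) with hF
      have e1 : x + t • h + u • h + F • e = x + t • h + φ t • e + (u • h + (F - φ t) • e) := by
        module
      rw [e1, inner_add_right, hi, inner_add_right, inner_smul_right, inner_smul_right] at h1
      have h5 : u * σ ≤ F - φ t := by
        by_contra! h6
        have := mul_pos_of_neg_of_neg (sub_neg.2 h6) hin
        have h7 : u * ⟪ν i, h⟫ = -(u * σ * ⟪ν i, e⟫) := by linear_combination u * hσ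
        rw [h7] at h1
        linarith
      linarith
    rcases eq_or_ne h 0 with rfl | hh
    · have : σ = 0 := by
        rw [inner_zero_right, zero_add] at hσ
        exact (mul_eq_zero.1 hσ).resolve_right hin.ne
      simp [this]
    · have hh' := norm_pos_iff.2 hh
      have hr := hf.pos
      have hru : |r / ‖h‖| * ‖h‖ ≤ r := by
        rw [abs_of_pos (div_pos hr hh'), div_mul_cancel₀ _ hh'.ne']
      have b1 := hbd (r / ‖h‖) hru
      have b2 := hbd (-(r / ‖h‖)) (by rwa [abs_neg])
      have b3 : r / ‖h‖ * |σ| ≤ r * (L + 1 / 2) := by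
        rcases abs_cases σ with ⟨h1, -⟩ | ⟨h1, -⟩ <;> rw [h1] <;> linarith
      have b4 : |σ| ≤ (L + 1 / 2) * ‖h‖ := by
        rw [div_mul_eq_mul_div, div_le_iff₀ hh', mul_assoc] at b3
        exact le_of_mul_le_mul_left b3 hr
      have b5 := pow_le_pow_left₀ (abs_nonneg σ) b4 2
      rw [sq_abs, mul_pow] at b5
      rw [hpyth]
      nlinarith [sq_nonneg (L - 1 / 2), sq_nonneg ‖h‖,
        mul_nonneg (sq_nonneg (L - 1 / 2)) (sq_nonneg ‖h‖)]
  · rintro t ht ⟨i, hi⟩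
    have hin := hneg t ht i _ le_rfl hi
    refine le_antisymm (hφle t ht) ?_
    by_contra! hlt
    have h1 := hleφ t i hin
    rw [hsub t (φ t) (f (x + t • h)), inner_add_right, hi, inner_smul_right] at h1
    have := mul_pos_of_neg_of_neg (sub_neg.2 hlt) hin
    linarith

end IsUpwardChart

/-- Concavity of the corrected squared intrinsic distance along segments, for charts with the
convex body above the graph. -/
theorem IsConvexBody.chord_le_sq_intrinsicDist [FiniteDimensional ℝ E]
    (hE : 2 ≤ Module.finrank ℝ E) {C : Set E} (hC : IsConvexBody C) {e₁ e₂ x₁ x₂ h₁ h₂ : E}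
    {L r₁ r₂ : ℝ} {f₁ f₂ : E → ℝ} (hf₁ : IsUpwardChart C e₁ x₁ h₁ L r₁ f₁)
    (hf₂ : IsUpwardChart C e₂ x₂ h₂ L r₂ f₂) {G : ℝ → ℝ}
    (hG : G = fun t => intrinsicDist (frontier C) (x₁ + t • h₁ + f₁ (x₁ + t • h₁) • e₁)
      (x₂ + t • h₂ + f₂ (x₂ + t • h₂) • e₂) ^ 2
        - 4 * (1 + L ^ 2) * (‖x₁ + t • h₁‖ ^ 2 + ‖x₂ + t • h₂‖ ^ 2)
        - 4 * intrinsicDiam (frontier C) * (f₁ (x₁ + t • h₁) + f₂ (x₂ + t • h₂)))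
    {t : ℝ} (ht : t ∈ Icc (0 : ℝ) 1) : (1 - t) * G 0 + t * G 1 ≤ G t := by
  classical
  obtain ⟨c₀, hc₀⟩ := hC.2.2
  obtain ⟨R, hR⟩ := hC.1.isBounded.subset_closedBall c₀
  have hM := hC.intrinsicDiam_pos hE
  set M := intrinsicDiam (frontier C) with hMd
  set p₁ : ℝ → E := fun t => x₁ + t • h₁ + f₁ (x₁ + t • h₁) • e₁ with hp₁
  set p₂ : ℝ → E := fun t => x₂ + t • h₂ + f₂ (x₂ + t • h₂) • e₂ with hp₂
  set d : ℝ → ℝ := fun t => intrinsicDist (frontier C) (p₁ t) (p₂ t) with hd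
  set Q : ℝ → ℝ := fun t => 4 * (1 + L ^ 2) * (‖x₁ + t • h₁‖ ^ 2 + ‖x₂ + t • h₂‖ ^ 2)
        + 4 * M * (f₁ (x₁ + t • h₁) + f₂ (x₂ + t • h₂)) with hQ
  have hGQ : ∀ t, G t = d t ^ 2 - Q t := fun t => by rw [hG]; simp only [hd, hQ, hp₁, hp₂]; ring
  have h0I : (0 : ℝ) ∈ Icc (0 : ℝ) 1 := by simp
  have h1I : (1 : ℝ) ∈ Icc (0 : ℝ) 1 := by simp
  have small : ∀ {u : ℝ → ℝ} {b : ℝ}, Continuous u → u 0 < b → ∀ᶠ ε in 𝓝[>] (0 : ℝ), u ε < b :=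
    fun {u b} hu hb => ((hu.tendsto 0).eventually_lt_const hb).filter_mono nhdsWithin_le_nhds
  have hev : ∀ᶠ ε in 𝓝[>] (0 : ℝ),
      (1 - t) * G 0 + t * G 1 ≤ ((1 + ε) * d t + 4 * ε * R) ^ 2 - Q t := by
    filter_upwards [self_mem_nhdsWithin, small (u := fun ε => ε) (b := 1) (by fun_prop) (by simp),
      small (u := fun ε => 2 * ((L + 1) * (ε * R))) (b := r₁) (by fun_prop) (by simpa using hf₁.pos),
      small (u := fun ε => 2 * ((L + 1) * (ε * R))) (b := r₂) (by fun_prop) (by simpa using hf₂.pos),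
      small (u := fun ε => (1 + ε) * M + 4 * ε * R) (b := 2 * M) (by fun_prop)
        (by linarith)] with ε hε hε1 hr₁ hr₂ hεM
    obtain ⟨S, ν, c, hP, hT⟩ := hC.exists_isOuterPolyhedron hE hc₀ hR hε hε1.le
      (T := {p₁ 0, p₁ t, p₁ 1, p₂ 0, p₂ t, p₂ 1}) (by
        intro z hz
        simp only [Finset.coe_insert, Finset.coe_singleton, mem_insert_iff,
          mem_singleton_iff] at hz
        rcases hz with rfl | rfl | rfl | rfl | rfl | rfl
        exacts [hf₁.mem_frontier h0I, hf₁.mem_frontier ht, hf₁.mem_frontier h1I,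
          hf₂.mem_frontier h0I, hf₂.mem_frontier ht, hf₂.mem_frontier h1I])
    have hT₁ : ∀ u ∈ ({0, t, 1} : Set ℝ), ∃ i, ⟪ν i, p₁ u⟫ = c i := by
      rintro u (rfl | rfl | rfl) <;> exact hT _ (by simp)
    have hT₂ : ∀ u ∈ ({0, t, 1} : Set ℝ), ∃ i, ⟪ν i, p₂ u⟫ = c i := by
      rintro u (rfl | rfl | rfl) <;> exact hT _ (by simp)
    obtain ⟨φ₁, hφ₁, hφf₁⟩ := hf₁.exists_isLowerGraph hR hε hP hr₁.le (hT₁ 0 (by simp))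
    obtain ⟨φ₂, hφ₂, hφf₂⟩ := hf₂.exists_isLowerGraph hR hε hP hr₂.le (hT₂ 0 (by simp))
    have hchord := chord_le_sq_intrinsicDist_lowerGraph hP.ne_top hφ₁ hφ₂ (M := M) (fun u hu =>
      (hP.le_intrinsicDiam _ _ (hφ₁.le u hu) (hφ₂.le u hu) (hφ₁.mem_exterior u)
        (hφ₂.mem_exterior u)).trans_lt hεM) rfl ht
    have hIcc : ∀ u ∈ ({0, t, 1} : Set ℝ), u ∈ Icc (0 : ℝ) 1 := by
      rintro u (rfl | rfl | rfl)
      exacts [h0I, ht, h1I]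
    have hΩ₁ : ∀ u ∈ ({0, t, 1} : Set ℝ), p₁ u ∈ {z | ∃ i, c i ≤ ⟪ν i, z⟫} := fun u hu =>
      (hT₁ u hu).imp fun _ h => h.ge
    have hΩ₂ : ∀ u ∈ ({0, t, 1} : Set ℝ), p₂ u ∈ {z | ∃ i, c i ≤ ⟪ν i, z⟫} := fun u hu =>
      (hT₂ u hu).imp fun _ h => h.ge
    have hlow : ∀ u ∈ ({0, t, 1} : Set ℝ),
        d u ≤ intrinsicDist {z | ∃ i, c i ≤ ⟪ν i, z⟫} (p₁ u) (p₂ u) := fun u hu =>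
      hP.intrinsicDist_le _ (hf₁.mem_self (hIcc u hu)) _ (hf₂.mem_self (hIcc u hu)) (hΩ₁ u hu)
        (hΩ₂ u hu)
    have hup : intrinsicDist {z | ∃ i, c i ≤ ⟪ν i, z⟫} (p₁ t) (p₂ t) ≤
        (1 + ε) * d t + 4 * ε * R :=
      hP.le_intrinsicDist _ (hf₁.mem_self ht) _ (hf₂.mem_self ht) (hΩ₁ t (by simp))
        (hΩ₂ t (by simp))
    have sq_low : ∀ u ∈ ({0, t, 1} : Set ℝ),
        d u ^ 2 ≤ intrinsicDist {z | ∃ i, c i ≤ ⟪ν i, z⟫} (p₁ u) (p₂ u) ^ 2 := fun u hu =>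
      pow_le_pow_left₀ (intrinsicDist_nonneg _ _ _) (hlow u hu) 2
    have sq_up := pow_le_pow_left₀ (intrinsicDist_nonneg _ _ _) hup 2
    simp only [hφf₁ 0 h0I (hT₁ 0 (by simp)), hφf₂ 0 h0I (hT₂ 0 (by simp)),
      hφf₁ t ht (hT₁ t (by simp)), hφf₂ t ht (hT₂ t (by simp)),
      hφf₁ 1 h1I (hT₁ 1 (by simp)), hφf₂ 1 h1I (hT₂ 1 (by simp))] at hchord
    have k0 := mul_le_mul_of_nonneg_left (sq_low 0 (by simp)) (sub_nonneg.2 ht.2)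
    have k1 := mul_le_mul_of_nonneg_left (sq_low 1 (by simp)) ht.1
    rw [hGQ, hGQ]
    simp only [hQ]
    simp only [hp₁, hp₂] at k0 k1 sq_up hchord ⊢
    linarith
  have hlim : Tendsto (fun ε => ((1 + ε) * d t + 4 * ε * R) ^ 2 - Q t) (𝓝[>] (0 : ℝ))
      (𝓝 (G t)) := by
    have hc : Continuous fun ε : ℝ => ((1 + ε) * d t + 4 * ε * R) ^ 2 - Q t := by fun_prop
    have h := (hc.tendsto 0).mono_left (nhdsWithin_le_nhds (s := Ioi 0))
    have h2 : ((1 + 0) * d t + 4 * 0 * R) ^ 2 - Q t = G t := by rw [hGQ]; ring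
    rwa [h2] at h
  exact ge_of_tendsto hlim hev

end UpwardChart

section StandardChart

open Filter Topology
open scoped RealInnerProductSpace

theorem lipschitzOnWith_lipConstOn {α β : Type*} [PseudoMetricSpace α] [PseudoMetricSpace β]
    {f : α → β} {s : Set α} (h : ∃ K : ℝ≥0, LipschitzOnWith K f s) :
    LipschitzOnWith (lipConstOn f s) f s := by
  rw [lipschitzOnWith_iff_dist_le_mul]
  intro a ha b hb
  obtain hab | hab := (dist_nonneg (x := a) (y := b)).eq_or_lt
  · obtain ⟨K, hK⟩ := h
    simpa [← hab] using hK.dist_le_mul a ha b hb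
  · rw [← div_le_iff₀ hab]
    have hle : nndist (f a) (f b) / nndist a b ≤ lipConstOn f s := by
      refine le_csInf h fun K hK => ?_
      rw [← NNReal.coe_le_coe, NNReal.coe_div, coe_nndist, coe_nndist, div_le_iff₀ hab]
      exact hK.dist_le_mul a ha b hb
    rw [← NNReal.coe_le_coe] at hle
    simpa using hle

variable {E : Type*} [NormedAddCommGroup E] [InnerProductSpace ℝ E] {C : Set E} {e : E}
  {V : Set ↥((Submodule.span ℝ {e})ᗮ)} {f : ↥((Submodule.span ℝ {e})ᗮ) → ℝ}

namespace IsStandardChart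

theorem mem_frontier (h : IsStandardChart (frontier C) e V f) {z} (hz : z ∈ V) :
    (z : E) + f z • e ∈ frontier C := by
  obtain ⟨-, -, -, -, -, O, -, hO⟩ := h
  exact (hO.subset (mem_image_of_mem _ hz)).1

theorem exists_mem_interior (h : IsStandardChart (frontier C) e V f) (hC : IsConvexBody C)
    {z} (hz : z ∈ V) : ∃ τ : ℝ, (z : E) + τ • e ∈ interior C := by
  obtain ⟨he, hV, -⟩ := id h
  obtain ⟨hcomp, hconv, hne⟩ := hC
  have hee : ⟪e, e⟫ = 1 := by rw [real_inner_self_eq_norm_sq, he, one_pow]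
  let p := (Submodule.span ℝ {e})ᗮ.orthogonalProjectionOnto
  have hpW : ∀ w : ↥((Submodule.span ℝ {e})ᗮ), p w = w :=
    fun w => Submodule.orthogonalProjectionOnto_mem_subspace_eq_self w
  have hpe : p e = 0 := Submodule.orthogonalProjectionOnto_orthogonalComplement_singleton_eq_zero e
  have hopen : IsOpen (p '' interior C) := by
    have hpo : IsOpenMap p := by
      intro U hU
      rw [isOpen_iff_mem_nhds]
      rintro _ ⟨u, hu, rfl⟩
      have : (fun w : ↥((Submodule.span ℝ {e})ᗮ) => u + (w - p u : E)) ⁻¹' U ∈ 𝓝 (p u) := by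
        apply ContinuousAt.preimage_mem_nhds
        · fun_prop
        · simpa using hU.mem_nhds hu
      filter_upwards [this] with w hw
      exact ⟨_, hw, by simp [hpW]⟩
    exact hpo _ isOpen_interior
  have hpconv : Convex ℝ (p '' interior C) := hconv.interior.linear_image p.toLinearMap
  have hsub : V ⊆ closure (p '' interior C) := by
    intro w hw
    have hwC : (w : E) + f w • e ∈ closure (interior C) := by
      rw [hconv.closure_interior_eq_closure_of_nonempty_interior hne]
      exact frontier_subset_closure (h.mem_frontier hw)
    have := image_closure_subset_closure_image p.continuous (mem_image_of_mem p hwC)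
    simpa [hpW, hpe] using this
  have hmem : z ∈ interior (closure (p '' interior C)) := interior_maximal hsub hV hz
  rw [hpconv.interior_closure_eq_interior_of_nonempty_interior
    (by rw [hopen.interior_eq]; exact hne.image p), hopen.interior_eq] at hmem
  obtain ⟨u, hu, rfl⟩ := hmem
  refine ⟨⟪e, u⟫, ?_⟩
  have hw : u - ⟪e, u⟫ • e ∈ (Submodule.span ℝ {e})ᗮ := by
    rw [Submodule.mem_orthogonal_singleton_iff_inner_right]
    rw [inner_sub_right, inner_smul_right, hee, mul_one, sub_self]
  have hpu : p u = ⟨_, hw⟩ := by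
    rw [← hpW ⟨_, hw⟩]
    simp [hpe]
  rw [hpu]
  simpa using hu

theorem exists_side (h : IsStandardChart (frontier C) e V f) (hC : IsConvexBody C) :
    ∃ σ : ℝ, (σ = 1 ∨ σ = -1) ∧ ∀ z ∈ V, ∃ τ > σ * f z, (z : E) + (σ * τ) • e ∈ interior C := by
  obtain ⟨-, hV, hVc, -, ⟨K, hK⟩, -⟩ := id h
  have hfc : ContinuousOn f V := hK.continuousOn
  have hopen : ∀ σ : ℝ, IsOpen {z ∈ V | ∃ τ > σ * f z, (z : E) + (σ * τ) • e ∈ interior C} := by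
    intro σ
    rw [isOpen_iff_mem_nhds]
    rintro z ⟨hz, τ, hτ, hzτ⟩
    have h₁ : ContinuousAt (fun z => σ * f z) z := (hfc.continuousAt (hV.mem_nhds hz)).const_mul σ
    have h₂ : ContinuousAt (fun z : ↥((Submodule.span ℝ {e})ᗮ) => (z : E) + (σ * τ) • e) z := by
      fun_prop
    filter_upwards [hV.mem_nhds hz, h₁.eventually_lt_const hτ,
      h₂.preimage_mem_nhds (isOpen_interior.mem_nhds hzτ)] with w hw hwτ hwC
    exact ⟨hw, τ, hwτ, hwC⟩
  have hdisj : Disjoint {z ∈ V | ∃ τ > 1 * f z, (z : E) + (1 * τ) • e ∈ interior C}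
      {z ∈ V | ∃ τ > -1 * f z, (z : E) + (-1 * τ) • e ∈ interior C} := by
    rw [Set.disjoint_left]
    rintro z ⟨hz, τ, hτ, hzτ⟩ ⟨-, τ', hτ', hzτ'⟩
    refine (h.mem_frontier hz).2 ?_
    have hpos : 0 < τ + τ' := by linarith
    have hmem := hC.2.1.interior hzτ hzτ' (a := (f z + τ') / (τ + τ')) (b := (τ - f z) / (τ + τ'))
      (div_nonneg (by linarith) hpos.le) (div_nonneg (by linarith) hpos.le) (by field_simp; ring)
    convert hmem using 1
    match_scalars <;> field_simp <;> ring
  have hcov : V ⊆ {z ∈ V | ∃ τ > 1 * f z, (z : E) + (1 * τ) • e ∈ interior C} ∪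
      {z ∈ V | ∃ τ > -1 * f z, (z : E) + (-1 * τ) • e ∈ interior C} := by
    intro z hz
    obtain ⟨τ, hτ⟩ := h.exists_mem_interior hC hz
    obtain hlt | rfl | hlt := lt_trichotomy τ (f z)
    · exact Or.inr ⟨hz, -τ, by linarith, by simpa using hτ⟩
    · exact absurd hτ (h.mem_frontier hz).2
    · exact Or.inl ⟨hz, τ, by linarith, by simpa using hτ⟩
  rcases hVc.isPreconnected.subset_or_subset (hopen 1) (hopen (-1)) hdisj hcov with hs | hs
  · exact ⟨1, Or.inl rfl, fun z hz => (hs hz).2⟩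
  · exact ⟨-1, Or.inr rfl, fun z hz => (hs hz).2⟩

theorem exists_isUpwardChart (h : IsStandardChart (frontier C) e V f) (hC : IsConvexBody C)
    {x y} (hx : x ∈ V) (hy : y ∈ V) {L : ℝ} (hL : (lipConstOn f V : ℝ) ≤ L) :
    ∃ (e' : E) (r : ℝ) (F : E → ℝ), IsUpwardChart C e' x (y - x : E) L r F ∧
      (∀ t ∈ Icc (0 : ℝ) 1, (x : E) + t • (y - x : E) + F (x + t • (y - x : E)) • e' =
        ((x + t • (y - x) : ↥((Submodule.span ℝ {e})ᗮ)) : E) + f (x + t • (y - x)) • e) ∧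
      ∀ t ∈ Icc (0 : ℝ) 1, F (x + t • (y - x : E)) - f (x + t • (y - x)) =
        (1 - t) * (F x - f x) + t * (F y - f y) := by
  obtain ⟨he, hV, hVc, hf, hK, -⟩ := id h
  obtain ⟨σ, hσ, hside⟩ := h.exists_side hC
  have hσσ : σ * σ = 1 := by rcases hσ with rfl | rfl <;> norm_num
  have hσa : |σ| = 1 := by rcases hσ with rfl | rfl <;> norm_num
  have hlip := lipschitzOnWith_lipConstOn hK
  let p := (Submodule.span ℝ {e})ᗮ.orthogonalProjectionOnto
  have hpW : ∀ w : ↥((Submodule.span ℝ {e})ᗮ), p w = w :=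
    fun w => Submodule.orthogonalProjectionOnto_mem_subspace_eq_self w
  have hle : ∀ z ∈ V, ∀ η : ℝ, (z : E) + η • σ • e ∈ C → σ * f z ≤ η := by
    intro z hz η hη
    by_contra! hlt
    obtain ⟨τ, hτ, hzτ⟩ := hside z hz
    refine (h.mem_frontier hz).2 (hC.2.1.openSegment_interior_self_subset_interior hzτ hη
      ⟨(σ * f z - η) / (τ - η), (τ - σ * f z) / (τ - η), div_pos (by linarith) (by linarith),
        div_pos (by linarith) (by linarith), ?_, ?_⟩)
    · rw [← add_div, div_eq_one_iff_eq (by linarith)]; ring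
    · have hne : τ - η ≠ 0 := by linarith
      match_scalars
      · field_simp; ring
      · field_simp
        linear_combination (τ - η) * f z * hσσ
  have hseg : ∀ t ∈ Icc (0 : ℝ) 1, x + t • (y - x) ∈ V :=
    fun t ht => hVc.add_smul_sub_mem hx hy ht
  have hcoe : ∀ t : ℝ, (x : E) + t • (y - x : E) =
    ((x + t • (y - x) : ↥((Submodule.span ℝ {e})ᗮ)) : E) := fun t => by simp
  obtain ⟨r, hr, hrV⟩ : ∃ r > 0, ∀ t ∈ Icc (0 : ℝ) 1, ∀ w : ↥((Submodule.span ℝ {e})ᗮ),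
      ‖w‖ ≤ r → x + t • (y - x) + w ∈ V := by
    have hcomp : IsCompact ((fun t : ℝ => x + t • (y - x)) '' Icc 0 1) :=
      isCompact_Icc.image (by fun_prop)
    obtain ⟨r, hr, hsub⟩ := hcomp.exists_cthickening_subset_open hV
      (by rintro _ ⟨t, ht, rfl⟩; exact hseg t ht)
    refine ⟨r, hr, fun t ht w hw => hsub ?_⟩
    exact Metric.mem_cthickening_of_dist_le _ _ _ _ (mem_image_of_mem _ ht) (by simpa using hw)
  have hval : ∀ w : ↥((Submodule.span ℝ {e})ᗮ), (σ * f (p w)) • σ • e = f w • e := by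
    intro w
    rw [hpW, smul_smul]
    congr 1
    linear_combination f w * hσσ
  have hperp : ∀ w : E, ⟪σ • e, w⟫ = 0 → ∃ w' : ↥((Submodule.span ℝ {e})ᗮ), (w' : E) = w := by
    intro w hw
    refine ⟨⟨w, ?_⟩, rfl⟩
    rw [Submodule.mem_orthogonal_singleton_iff_inner_right]
    rw [real_inner_smul_left] at hw
    exact (mul_eq_zero.1 hw).resolve_left (by rintro rfl; simp at hσσ)
  refine ⟨σ • e, r, fun z => σ * f (p z), ⟨?_, ?_, hr, (NNReal.coe_nonneg _).trans hL, ?_, ?_, ?_,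
    ?_⟩, ?_, ?_⟩
  · rw [norm_smul, he, Real.norm_eq_abs, hσa, one_mul]
  · have := Submodule.mem_orthogonal_singleton_iff_inner_right.1 (y - x).2
    rw [real_inner_smul_left]
    simp only [AddSubgroupClass.coe_sub] at this
    rw [this, mul_zero]
  · intro t ht w hw hwr
    obtain ⟨w, rfl⟩ := hperp w hw
    rw [hcoe, ← Submodule.coe_add, hval]
    exact hC.1.isClosed.frontier_subset (h.mem_frontier (hrV t ht w hwr))
  · intro t ht w hw hwr η hη
    obtain ⟨w, rfl⟩ := hperp w hw
    rw [hcoe, ← Submodule.coe_add] at hη ⊢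
    rw [hpW]
    exact hle _ (hrV t ht w hwr) η hη
  · intro t ht w hw hwr
    obtain ⟨w, rfl⟩ := hperp w hw
    rw [hcoe, ← Submodule.coe_add, hpW, hpW, ← mul_sub, abs_mul, hσa, one_mul]
    have := hlip.dist_le_mul _ (hrV t ht w hwr) _ (hseg t ht)
    rw [Real.dist_eq, dist_eq_norm, add_sub_cancel_left] at this
    exact this.trans (mul_le_mul_of_nonneg_right hL (norm_nonneg _))
  · intro t ht
    rw [hcoe, hpW]
    obtain ⟨τ, hτ, hzτ⟩ := hside _ (hseg t ht)
    exact ⟨τ, hτ, by rwa [smul_smul, mul_comm τ]⟩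
  · intro t ht
    simp only
    rw [hcoe, hval]
  · intro t ht
    simp only
    rw [hcoe, hpW, hpW, hpW]
    rcases hσ with rfl | rfl
    · ring
    · have h0 : (0 : ℝ) ≤ 1 - t := by linarith [ht.2]
      have hz : (1 - t) • x + t • y = x + t • (y - x) := by module
      have h₁ := hf.2 hx hy h0 ht.1 (by ring)
      rw [hz] at h₁
      have h₂ := hle _ (hseg t ht) (-((1 - t) * f x + t * f y)) (by
        convert hC.2.1 (hC.1.isClosed.frontier_subset (h.mem_frontier hx))
          (hC.1.isClosed.frontier_subset (h.mem_frontier hy)) h0 ht.1 (by ring) using 1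
        rw [← hcoe]
        module)
      simp only [smul_eq_mul] at h₁
      have : f (x + t • (y - x)) = (1 - t) * f x + t * f y := by linarith
      rw [this]
      ring

end IsStandardChart

theorem IsConvexBody.concaveOn_sq_intrinsicDist [FiniteDimensional ℝ E]
    (hE : 2 ≤ Module.finrank ℝ E) (hC : IsConvexBody C) {e₁ e₂ : E}
    {V₁ : Set ↥((Submodule.span ℝ {e₁})ᗮ)} {f₁ : ↥((Submodule.span ℝ {e₁})ᗮ) → ℝ}
    {V₂ : Set ↥((Submodule.span ℝ {e₂})ᗮ)} {f₂ : ↥((Submodule.span ℝ {e₂})ᗮ) → ℝ}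
    (h₁ : IsStandardChart (frontier C) e₁ V₁ f₁) (h₂ : IsStandardChart (frontier C) e₂ V₂ f₂)
    {L : ℝ} (hL₁ : (lipConstOn f₁ V₁ : ℝ) ≤ L) (hL₂ : (lipConstOn f₂ V₂ : ℝ) ≤ L) :
    ConcaveOn ℝ (V₁ ×ˢ V₂)
      (fun p : ↥((Submodule.span ℝ {e₁})ᗮ) × ↥((Submodule.span ℝ {e₂})ᗮ) =>
        intrinsicDist (frontier C) ((p.1 : E) + f₁ p.1 • e₁) ((p.2 : E) + f₂ p.2 • e₂) ^ 2
          - 4 * (1 + L ^ 2) * (‖p.1‖ ^ 2 + ‖p.2‖ ^ 2)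
          - 4 * intrinsicDiam (frontier C) * (f₁ p.1 + f₂ p.2)) := by
  refine ⟨h₁.2.2.1.prod h₂.2.2.1, ?_⟩
  rintro ⟨x₁, x₂⟩ hx ⟨y₁, y₂⟩ hy a t ha ht hat
  obtain rfl : a = 1 - t := by linarith
  have hx₁ : x₁ ∈ V₁ := hx.1
  have hx₂ : x₂ ∈ V₂ := hx.2
  have hy₁ : y₁ ∈ V₁ := hy.1
  have hy₂ : y₂ ∈ V₂ := hy.2
  obtain ⟨e₁', r₁, F₁, hF₁, hpt₁, haff₁⟩ := h₁.exists_isUpwardChart hC hx₁ hy₁ hL₁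
  obtain ⟨e₂', r₂, F₂, hF₂, hpt₂, haff₂⟩ := h₂.exists_isUpwardChart hC hx₂ hy₂ hL₂
  have htI : t ∈ Icc (0 : ℝ) 1 := ⟨ht, by linarith⟩
  have key := hC.chord_le_sq_intrinsicDist hE hF₁ hF₂ rfl htI
  have h0 : (0 : ℝ) ∈ Icc (0 : ℝ) 1 := by simp
  have h1 : (1 : ℝ) ∈ Icc (0 : ℝ) 1 := by simp
  rw [hpt₁ t htI, hpt₂ t htI, hpt₁ 0 h0, hpt₂ 0 h0, hpt₁ 1 h1, hpt₂ 1 h1] at key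
  have hz₁ : (1 - t) • x₁ + t • y₁ = x₁ + t • (y₁ - x₁) := by module
  have hz₂ : (1 - t) • x₂ + t • y₂ = x₂ + t • (y₂ - x₂) := by module
  have hn₁ : ‖x₁ + t • (y₁ - x₁)‖ = ‖(x₁ : E) + t • (y₁ - x₁ : E)‖ := rfl
  have hn₂ : ‖x₂ + t • (y₂ - x₂)‖ = ‖(x₂ : E) + t • (y₂ - x₂ : E)‖ := rfl
  simp only [zero_smul, one_smul, add_zero, add_sub_cancel] at key
  simp only [Prod.smul_mk, Prod.mk_add_mk, hz₁, hz₂, smul_eq_mul, hn₁, hn₂]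
  simp only [Submodule.coe_norm]
  linear_combination key - 4 * intrinsicDiam (frontier C) * (haff₁ t htI + haff₂ t htI)

end StandardChart

theorem IsStandardChart.subsingleton {n : ℕ} (hn : n = 0) {X : Set (EuclideanSpace ℝ (Fin (n + 1)))}
    {e : EuclideanSpace ℝ (Fin (n + 1))} {V : Set ↥((Submodule.span ℝ {e})ᗮ)}
    {f : ↥((Submodule.span ℝ {e})ᗮ) → ℝ} (h : IsStandardChart X e V f) :
    Subsingleton ↥((Submodule.span ℝ {e})ᗮ) := by
  have : Fact (Module.finrank ℝ (EuclideanSpace ℝ (Fin (n + 1))) = n + 1) := ⟨by simp⟩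
  have he : e ≠ 0 := by
    rintro rfl
    simpa using h.1
  rw [← Module.finrank_zero_iff (R := ℝ), Submodule.finrank_orthogonal_span_singleton (n := n) he, hn]

/-- Let `X ⊂ ℝ^{n+1}` be a convex surface with `(e₁,V₁)`- and
`(e₂,V₂)`-standard charts with associated convex functions `f₁, f₂`. With
`g(x₁,x₂) = dist_X(x₁+f₁(x₁)e₁, x₂+f₂(x₂)e₂)²`, `L = max(Lip f₁, Lip f₂)` and `M` the
intrinsic diameter of `X`, the function
`(x₁,x₂) ↦ g(x₁,x₂) − 4(1+L²)(‖x₁‖²+‖x₂‖²) − 4M(f₁(x₁)+f₂(x₂))`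
is concave on `V₁ × V₂`. -/
theorem squared_intrinsicDist_concavity (n : ℕ)
    (X : Set (EuclideanSpace ℝ (Fin (n + 1)))) (hX : IsConvexSurface X)
    (e₁ e₂ : EuclideanSpace ℝ (Fin (n + 1)))
    (V₁ : Set ↥((Submodule.span ℝ {e₁})ᗮ)) (f₁ : ↥((Submodule.span ℝ {e₁})ᗮ) → ℝ)
    (V₂ : Set ↥((Submodule.span ℝ {e₂})ᗮ)) (f₂ : ↥((Submodule.span ℝ {e₂})ᗮ) → ℝ)
    (hchart₁ : IsStandardChart X e₁ V₁ f₁) (hchart₂ : IsStandardChart X e₂ V₂ f₂)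
    (L M : ℝ)
    (hL : L = max (lipConstOn f₁ V₁ : ℝ) (lipConstOn f₂ V₂ : ℝ))
    (hM : M = intrinsicDiam X) :
    ConcaveOn ℝ (V₁ ×ˢ V₂)
      (fun p : ↥((Submodule.span ℝ {e₁})ᗮ) × ↥((Submodule.span ℝ {e₂})ᗮ) =>
        intrinsicDist X ((p.1 : EuclideanSpace ℝ (Fin (n + 1))) + f₁ p.1 • e₁)
            ((p.2 : EuclideanSpace ℝ (Fin (n + 1))) + f₂ p.2 • e₂) ^ 2
          - 4 * (1 + L ^ 2) * (‖p.1‖ ^ 2 + ‖p.2‖ ^ 2)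
          - 4 * M * (f₁ p.1 + f₂ p.2)) := by
  obtain ⟨C, hC, rfl⟩ := hX
  subst hM
  obtain hn | hn := Nat.eq_zero_or_pos n
  · have := hchart₁.subsingleton hn
    have := hchart₂.subsingleton hn
    refine ⟨hchart₁.2.2.1.prod hchart₂.2.2.1, fun p _ q _ a b _ _ hab => ?_⟩
    rw [Subsingleton.elim q p, ← add_smul, ← add_smul, hab, one_smul, one_smul]
  · refine hC.concaveOn_sq_intrinsicDist ?_ hchart₁ hchart₂ ?_ ?_
    · rw [finrank_euclideanSpace_fin]
      omega
    · exact hL ▸ le_max_left _ _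
    · exact hL ▸ le_max_right _ _
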